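/- arXiv:0809.0849 — 4 statements merged into one kernel-verified Lean document; each statement's English description precedes it below -/
import Mathlib

section
/- Let 0 < α ≤ 2 and define p₁ : ℝ → ℝ by p₁(x) = (1/π) ∫₀^∞ cos(ux) e^{−u^α} du. Then p₁ is infinitely differentiable and for every integer n ≥ 0 and every ε > 0 there exists a constant c_n(ε) < ∞ such that |x|^{α+1+n} |p₁^{(n)}(x)| ≤ c_n(ε) for all x with |x| > ε, where p₁^{(n)} denotes the n-th derivative of p₁. -/
open MeasureTheory Real Set

open Filter Topology in
/-- Decay of powers against stretched exponentials. -/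
lemma stb_tendsto (α c s : ℝ) (h0 : 0 < α) (hc : 0 < c) :
    Tendsto (fun r : ℝ => r ^ s * Real.exp (-c * r ^ α)) atTop (𝓝 0) := by
  have h := (tendsto_rpow_mul_exp_neg_mul_atTop_nhds_zero (s / α) c hc).comp
    (tendsto_rpow_atTop h0)
  refine h.congr' ?_
  filter_upwards [eventually_gt_atTop 0] with r hr
  simp only [Function.comp]
  rw [← Real.rpow_mul hr.le, mul_div_cancel₀ _ h0.ne']

lemma stb_int (α c : ℝ) (h0 : 0 < α) (hc : 0 < c) (s : ℝ) (hs : -1 < s) :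
    IntegrableOn (fun r : ℝ => r ^ s * Real.exp (-c * r ^ α)) (Ioi 0) :=
  integrableOn_rpow_mul_exp_neg_mul_rpow hs h0 hc

lemma stb_int_nat (α c : ℝ) (h0 : 0 < α) (hc : 0 < c) (n : ℕ) :
    IntegrableOn (fun r : ℝ => r ^ n * Real.exp (-c * r ^ α)) (Ioi 0) := by
  have := stb_int α c h0 hc n (by have : (0:ℝ) ≤ n := n.cast_nonneg
                                  linarith)
  simpa only [Real.rpow_natCast] using this

/-- The Laplace transform of a monomial on the right half plane. -/
lemma stb_laplace_int (z : ℂ) (hz : 0 < z.re) (n : ℕ) :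
    IntegrableOn (fun r : ℝ => (r : ℂ) ^ n * Complex.exp (-z * r)) (Ioi 0) := by
  have h := stb_int_nat 1 z.re one_pos hz n
  refine Integrable.mono' h (by fun_prop) ?_
  filter_upwards [ae_restrict_mem measurableSet_Ioi] with r hr
  have hr : 0 < r := hr
  simp [Complex.norm_exp, abs_of_pos hr]

lemma stb_laplace (z : ℂ) (hz : 0 < z.re) (n : ℕ) :
    ∫ r in Ioi (0:ℝ), (r : ℂ) ^ n * Complex.exp (-z * r) = n.factorial / z ^ (n + 1) := by
  have hz0 : z ≠ 0 := by rintro rfl; simp at hz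
  have key : ∀ n : ℕ, ∫ r in Ioi (0:ℝ), ((n:ℂ) * (r : ℂ) ^ (n-1) * Complex.exp (-z * r)
        - z * ((r : ℂ) ^ n * Complex.exp (-z * r))) = 0 - ((0:ℝ):ℂ)^n * Complex.exp (-z * (0:ℝ)) := by
    intro n
    refine integral_Ioi_of_hasDerivAt_of_tendsto
      (f := fun r : ℝ => (r : ℂ) ^ n * Complex.exp (-z * r)) ?_ ?_ ?_ ?_
    · exact Continuous.continuousWithinAt (by fun_prop)
    · intro r hr
      have h1 : HasDerivAt (fun w : ℂ => w ^ n * Complex.exp (-z * w))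
          ((n:ℂ) * (r : ℂ) ^ (n-1) * Complex.exp (-z * r)
            + (r : ℂ) ^ n * (Complex.exp (-z * r) * (-z * 1))) (r : ℂ) :=
        (hasDerivAt_pow n (r:ℂ)).mul (((hasDerivAt_id (r:ℂ)).const_mul (-z)).cexp)
      exact h1.comp_ofReal.congr_deriv (by ring)
    · have := ((stb_laplace_int z hz (n-1)).const_mul (n:ℂ)).sub
        ((stb_laplace_int z hz n).const_mul z)
      refine this.congr (Filter.Eventually.of_forall fun r => ?_)
      simp [mul_assoc]
    · rw [tendsto_zero_iff_norm_tendsto_zero]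
      refine (stb_tendsto 1 z.re n one_pos hz).congr' ?_
      filter_upwards [Filter.eventually_gt_atTop 0] with r hr
      simp [Complex.norm_exp, abs_of_pos hr]
  induction n with
  | zero =>
    have h := key 0
    simp only [Nat.cast_zero, zero_mul, zero_sub, integral_neg, pow_zero, one_mul] at h
    rw [integral_const_mul] at h
    simp only [pow_zero, one_mul, zero_add, pow_one, Nat.factorial_zero, Nat.cast_one]
    rw [eq_div_iff hz0]
    simp at h ⊢
    linear_combination h
  | succ m ih =>
    have h := key (m + 1)
    rw [integral_sub, integral_const_mul] at h
    · simp only [mul_assoc, integral_const_mul, Nat.add_sub_cancel] at h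
      rw [ih] at h
      rw [eq_div_iff (pow_ne_zero _ hz0)]
      rw [Nat.factorial_succ]
      push_cast at h ⊢
      field_simp at h
      simp at h ⊢
      linear_combination (-1 : ℂ) * h
    · simpa [mul_assoc] using (stb_laplace_int z hz m).const_mul ((m:ℂ)+1)
    · exact (stb_laplace_int z hz (m+1)).const_mul z

/-- The integrand on the ray of angle `θ`. -/
noncomputable def stbE (α x : ℝ) (n : ℕ) (θ r : ℝ) : ℂ :=
  Complex.exp (Complex.I * (n + 1) * θ + Complex.I * x * r * Complex.exp (Complex.I * θ)
    - ((r ^ α : ℝ) : ℂ) * Complex.exp (Complex.I * (α * θ)))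

noncomputable def stbG (α x : ℝ) (n : ℕ) (θ r : ℝ) : ℂ :=
  Complex.I * (n + 1) + Complex.I * x * r * (Complex.I * Complex.exp (Complex.I * θ))
    - ((r ^ α : ℝ) : ℂ) * (Complex.I * α * Complex.exp (Complex.I * (α * θ)))

lemma stb_re (t : ℝ) : (Complex.exp (Complex.I * t)).re = Real.cos t := by
  rw [mul_comm, Complex.exp_ofReal_mul_I_re]

lemma stb_im (t : ℝ) : (Complex.exp (Complex.I * t)).im = Real.sin t := by
  rw [mul_comm, Complex.exp_ofReal_mul_I_im]

lemma stb_nrm (t : ℝ) : ‖Complex.exp (Complex.I * t)‖ = 1 := by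
  rw [mul_comm, Complex.norm_exp_ofReal_mul_I]

lemma stb_nrm' (a t : ℝ) : ‖Complex.exp (Complex.I * (a * t))‖ = 1 := by
  have := stb_nrm (a * t); push_cast at this; exact this

lemma stb_norm (α x : ℝ) (n : ℕ) (θ r : ℝ) :
    ‖stbE α x n θ r‖ = Real.exp (-(x * r * Real.sin θ) - r ^ α * Real.cos (α * θ)) := by
  unfold stbE
  rw [Complex.norm_exp]
  congr 1
  have h1 := stb_re (α * θ)
  have h2 := stb_im θ
  push_cast at h1
  rw [Complex.sub_re, Complex.add_re, Complex.re_ofReal_mul, h1]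
  have : Complex.I * (x:ℂ) * r * Complex.exp (Complex.I * θ)
    = ((x * r : ℝ) : ℂ) * (Complex.I * Complex.exp (Complex.I * θ)) := by push_cast; ring
  rw [this, Complex.re_ofReal_mul, Complex.I_mul_re, h2]
  simp

lemma stb_cos (α θ : ℝ) (h0 : 0 < α) (h2 : α ≤ 2) (hθ0 : 0 ≤ θ) (hθ : θ ≤ π / 8) :
    Real.cos (π / 4) ≤ Real.cos (α * θ) := by
  apply Real.cos_le_cos_of_nonneg_of_le_pi
  · positivity
  · linarith [Real.pi_pos]
  · nlinarith [Real.pi_pos]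

lemma stb_cpos : 0 < Real.cos (π / 4) := by
  rw [Real.cos_pi_div_four]; positivity

lemma stb_norm_le (α x : ℝ) (n : ℕ) (θ r : ℝ) (h0 : 0 < α) (h2 : α ≤ 2) (hx : 0 ≤ x)
    (hθ0 : 0 ≤ θ) (hθ : θ ≤ π / 8) (hr : 0 ≤ r) :
    ‖stbE α x n θ r‖ ≤ Real.exp (-Real.cos (π / 4) * r ^ α) := by
  rw [stb_norm]
  apply Real.exp_le_exp.mpr
  have h1 := stb_cos α θ h0 h2 hθ0 hθ
  have h3 : 0 ≤ Real.sin θ := Real.sin_nonneg_of_nonneg_of_le_pi hθ0 (by linarith [Real.pi_pos])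
  have h4 : 0 ≤ r ^ α := by positivity
  have h5 : 0 ≤ x * r * Real.sin θ := by positivity
  nlinarith

lemma stb_G_le (α x : ℝ) (n : ℕ) (θ r : ℝ) (h0 : 0 < α) (hx : 0 ≤ x) (hr : 0 ≤ r) :
    ‖stbG α x n θ r‖ ≤ (n + 1) + x * r + r ^ α * α := by
  unfold stbG
  have h4 : 0 ≤ r ^ α := by positivity
  refine (norm_sub_le _ _).trans (add_le_add ((norm_add_le _ _).trans (add_le_add ?_ ?_)) ?_)
  · rw [norm_mul, Complex.norm_I, one_mul]
    have : ((n:ℂ) + 1) = ((n + 1 : ℕ) : ℂ) := by push_cast; rfl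
    rw [this, Complex.norm_natCast]; push_cast; rfl
  · simp [abs_of_nonneg hx, abs_of_nonneg hr]
  · simp only [norm_mul, Complex.norm_I, stb_nrm', Complex.norm_real, one_mul, mul_one]
    rw [Real.norm_of_nonneg h4, Real.norm_of_nonneg h0.le]

lemma stb_dtheta (α x : ℝ) (n : ℕ) (θ r : ℝ) :
    HasDerivAt (fun t : ℝ => stbE α x n t r) (stbE α x n θ r * stbG α x n θ r) θ := by
  have h : HasDerivAt (fun w : ℂ => Complex.exp (Complex.I * (n + 1) * w
      + Complex.I * x * r * Complex.exp (Complex.I * w)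
      - ((r ^ α : ℝ) : ℂ) * Complex.exp (Complex.I * (α * w))))
      (stbE α x n θ r * stbG α x n θ r) (θ : ℂ) := by
    have a1 : HasDerivAt (fun w : ℂ => Complex.I * (n + 1) * w) (Complex.I * (n + 1) * 1) (θ:ℂ) :=
      (hasDerivAt_id (θ:ℂ)).const_mul _
    have a2 := (((hasDerivAt_id (θ:ℂ)).const_mul Complex.I).cexp).const_mul (Complex.I * x * r)
    have a3 := ((((hasDerivAt_id (θ:ℂ)).const_mul (α:ℂ)).const_mul Complex.I).cexp).const_mul
      ((r ^ α : ℝ) : ℂ)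
    have := ((a1.add a2).sub a3).cexp
    refine this.congr_deriv ?_
    unfold stbE stbG
    simp only [id, Pi.add_apply, Pi.sub_apply]
    congr 1
    ring
  exact h.comp_ofReal

lemma stb_dr (α x : ℝ) (n : ℕ) (θ r : ℝ) (hr : 0 < r) :
    HasDerivAt (fun t : ℝ => Complex.I * ((t : ℂ) ^ (n + 1) * stbE α x n θ t))
      ((r : ℂ) ^ n * (stbE α x n θ r * stbG α x n θ r)) r := by
  have hrC : HasDerivAt (fun t : ℝ => (t : ℂ)) 1 r := Complex.ofRealCLM.hasDerivAt
  have a0 : HasDerivAt (fun t : ℝ => (t : ℂ) ^ (n + 1)) (((n + 1 : ℕ) : ℂ) * (r:ℂ) ^ n) r := by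
    have := (hasDerivAt_pow (n + 1) (r:ℂ)).comp_ofReal
    simpa using this
  have a1 : HasDerivAt (fun t : ℝ => ((t ^ α : ℝ) : ℂ)) ((α * r ^ (α - 1) : ℝ) : ℂ) r :=
    (Real.hasDerivAt_rpow_const (Or.inl hr.ne')).ofReal_comp
  have a2 : HasDerivAt (fun t : ℝ => Complex.I * (n + 1) * θ
      + Complex.I * x * t * Complex.exp (Complex.I * θ)
      - ((t ^ α : ℝ) : ℂ) * Complex.exp (Complex.I * (α * θ)))
      (Complex.I * x * 1 * Complex.exp (Complex.I * θ)
       - ((α * r ^ (α - 1) : ℝ) : ℂ) * Complex.exp (Complex.I * (α * θ))) r :=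
    (((hrC.const_mul (Complex.I * x)).mul_const _).const_add _).sub (a1.mul_const _)
  have a3 := (a0.mul a2.cexp).const_mul Complex.I
  refine a3.congr_deriv ?_
  have hp : ((r ^ α : ℝ) : ℂ) = ((r ^ (α - 1) : ℝ) : ℂ) * r := by
    rw [← Complex.ofReal_mul, Real.rpow_sub_one hr.ne', div_mul_cancel₀ _ hr.ne']
  change Complex.I * (((n + 1 : ℕ) : ℂ) * (r:ℂ) ^ n * stbE α x n θ r + (r:ℂ) ^ (n + 1) *
    (stbE α x n θ r * _)) = _
  unfold stbG
  rw [hp]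
  push_cast
  ring

lemma stb_meas (α x : ℝ) (n : ℕ) (θ : ℝ) : Measurable (stbE α x n θ) := by
  unfold stbE; fun_prop

lemma stb_measG (α x : ℝ) (n : ℕ) (θ : ℝ) : Measurable (stbG α x n θ) := by
  unfold stbG; fun_prop

noncomputable def stbBound (α x : ℝ) (n : ℕ) (r : ℝ) : ℝ :=
  r ^ n * (Real.exp (-Real.cos (π / 4) * r ^ α) * ((n + 1) + x * r + r ^ α * α))

lemma stb_bound_int (α x : ℝ) (n : ℕ) (h0 : 0 < α) :
    IntegrableOn (stbBound α x n) (Ioi 0) := by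
  have hn : (0:ℝ) ≤ n := n.cast_nonneg
  have i1 := (stb_int_nat α _ h0 stb_cpos n).const_mul ((n:ℝ) + 1)
  have i2 := (stb_int_nat α _ h0 stb_cpos (n+1)).const_mul x
  have i3 := (stb_int α _ h0 stb_cpos (n + α) (by linarith)).const_mul α
  refine IntegrableOn.congr_fun ((i1.add i2).add i3) ?_ measurableSet_Ioi
  intro r hr
  have hr : 0 < r := hr
  simp only [Pi.add_apply, stbBound]
  rw [Real.rpow_add hr, Real.rpow_natCast]
  ring

lemma stb_le_bound (α x : ℝ) (n : ℕ) (θ r : ℝ) (h0 : 0 < α) (h2 : α ≤ 2) (hx : 0 ≤ x)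
    (hθ0 : 0 ≤ θ) (hθ : θ ≤ π / 8) (hr : 0 ≤ r) :
    ‖(r : ℂ) ^ n * (stbE α x n θ r * stbG α x n θ r)‖ ≤ stbBound α x n r := by
  rw [norm_mul, norm_mul, norm_pow, Complex.norm_real, Real.norm_of_nonneg hr]
  unfold stbBound
  gcongr
  · exact stb_norm_le α x n θ r h0 h2 hx hθ0 hθ hr
  · exact stb_G_le α x n θ r h0 hx hr

lemma stb_le_bound0 (α x : ℝ) (n : ℕ) (θ r : ℝ) (h0 : 0 < α) (h2 : α ≤ 2) (hx : 0 ≤ x)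
    (hθ0 : 0 ≤ θ) (hθ : θ ≤ π / 8) (hr : 0 ≤ r) :
    ‖(r : ℂ) ^ n * stbE α x n θ r‖ ≤ r ^ n * Real.exp (-Real.cos (π / 4) * r ^ α) := by
  rw [norm_mul, norm_pow, Complex.norm_real, Real.norm_of_nonneg hr]
  gcongr
  exact stb_norm_le α x n θ r h0 h2 hx hθ0 hθ hr

lemma stb_integrable (α x : ℝ) (n : ℕ) (θ : ℝ) (h0 : 0 < α) (h2 : α ≤ 2) (hx : 0 ≤ x)
    (hθ0 : 0 ≤ θ) (hθ : θ ≤ π / 8) :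
    IntegrableOn (fun r : ℝ => (r : ℂ) ^ n * stbE α x n θ r) (Ioi 0) := by
  refine Integrable.mono' (stb_int_nat α _ h0 stb_cpos n) ?_ ?_
  · have := stb_meas α x n θ
    exact Measurable.aestronglyMeasurable (by fun_prop)
  · filter_upwards [ae_restrict_mem measurableSet_Ioi] with r hr
    exact stb_le_bound0 α x n θ r h0 h2 hx hθ0 hθ (le_of_lt hr)

lemma stb_zero (α x : ℝ) (n : ℕ) (θ : ℝ) (h0 : 0 < α) (h2 : α ≤ 2) (hx : 0 ≤ x)
    (hθ0 : 0 ≤ θ) (hθ : θ ≤ π / 8) :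
    ∫ r in Ioi (0:ℝ), (r : ℂ) ^ n * (stbE α x n θ r * stbG α x n θ r) = 0 := by
  have := integral_Ioi_of_hasDerivAt_of_tendsto (a := 0) (m := 0)
    (f := fun t : ℝ => Complex.I * ((t : ℂ) ^ (n + 1) * stbE α x n θ t))
    (f' := fun r : ℝ => (r : ℂ) ^ n * (stbE α x n θ r * stbG α x n θ r)) ?_ ?_ ?_ ?_
  · rw [this]; simp
  · apply Continuous.continuousWithinAt
    unfold stbE
    have : Continuous fun t : ℝ => t ^ α := Real.continuous_rpow_const h0.le
    fun_prop
  · intro r hr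
    exact stb_dr α x n θ r hr
  · refine Integrable.mono' (stb_bound_int α x n h0) ?_ ?_
    · have := stb_meas α x n θ
      have := stb_measG α x n θ
      exact Measurable.aestronglyMeasurable (by fun_prop)
    · filter_upwards [ae_restrict_mem measurableSet_Ioi] with r hr
      exact stb_le_bound α x n θ r h0 h2 hx hθ0 hθ (le_of_lt hr)
  · rw [tendsto_zero_iff_norm_tendsto_zero]
    refine squeeze_zero' (Filter.Eventually.of_forall fun _ => norm_nonneg _) ?_
      (stb_tendsto α _ ((n + 1 : ℕ) : ℝ) h0 stb_cpos)
    filter_upwards [Filter.eventually_gt_atTop 0] with r hr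
    rw [norm_mul, Complex.norm_I, one_mul, norm_mul, norm_pow, Complex.norm_real,
      Real.norm_of_nonneg hr.le, Real.rpow_natCast]
    gcongr
    exact stb_norm_le α x n θ r h0 h2 hx hθ0 hθ hr.le

/-- Rotation of the contour. -/
lemma stb_rotate (α x : ℝ) (n : ℕ) (h0 : 0 < α) (h2 : α ≤ 2) (hx : 0 ≤ x) :
    ∫ r in Ioi (0:ℝ), (r : ℂ) ^ n * stbE α x n (π / 8) r
      = ∫ r in Ioi (0:ℝ), (r : ℂ) ^ n * stbE α x n 0 r := by
  have hpi := Real.pi_pos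
  set F : ℝ → ℂ := fun θ => ∫ r in Ioi (0:ℝ), (r : ℂ) ^ n * stbE α x n θ r with hF
  have hcont : ContinuousOn F (Icc 0 (π / 8)) := by
    refine continuousOn_of_dominated (bound := fun r => r ^ n * Real.exp (-Real.cos (π / 4) * r ^ α))
      ?_ ?_ (stb_int_nat α _ h0 stb_cpos n) ?_
    · intro θ hθ
      exact (stb_integrable α x n θ h0 h2 hx hθ.1 hθ.2).aestronglyMeasurable
    · intro θ hθ
      filter_upwards [ae_restrict_mem measurableSet_Ioi] with r hr
      exact stb_le_bound0 α x n θ r h0 h2 hx hθ.1 hθ.2 (le_of_lt hr)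
    · refine Filter.Eventually.of_forall fun r => ?_
      unfold stbE
      fun_prop
  have hder : ∀ θ ∈ Ioo 0 (π / 8), HasDerivAt F 0 θ := by
    intro θ hθ
    have := (hasDerivAt_integral_of_dominated_loc_of_deriv_le (μ := volume.restrict (Ioi (0:ℝ)))
      (F := fun θ r => (r : ℂ) ^ n * stbE α x n θ r)
      (F' := fun θ r => (r : ℂ) ^ n * (stbE α x n θ r * stbG α x n θ r))
      (bound := stbBound α x n)
      (Ioo_mem_nhds hθ.1 hθ.2) ?_ (stb_integrable α x n θ h0 h2 hx hθ.1.le hθ.2.le) ?_ ?_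
      (stb_bound_int α x n h0) ?_).2
    · rw [stb_zero α x n θ h0 h2 hx hθ.1.le hθ.2.le] at this
      exact this
    · refine Filter.Eventually.of_forall fun t => ?_
      have := stb_meas α x n t
      exact Measurable.aestronglyMeasurable (by fun_prop)
    · have := stb_meas α x n θ
      have := stb_measG α x n θ
      exact Measurable.aestronglyMeasurable (by fun_prop)
    · filter_upwards [ae_restrict_mem measurableSet_Ioi] with r hr t ht
      exact stb_le_bound α x n t r h0 h2 hx ht.1.le ht.2.le (le_of_lt hr)
    · refine Filter.Eventually.of_forall fun r t ht => ?_
      exact (stb_dtheta α x n t r).const_mul _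
  -- constant on [a, π/8] for a > 0, then let a tend to 0
  have hconst : ∀ a ∈ Ioo 0 (π / 8), F a = F (π / 8) := by
    intro a ha
    refine (constant_of_has_deriv_right_zero (f := F) (a := a) (b := π / 8)
      (hcont.mono (Icc_subset_Icc ha.1.le le_rfl)) ?_ (π / 8) ⟨ha.2.le, le_rfl⟩).symm
    intro t ht
    exact (hder t ⟨ha.1.trans_le ht.1, ht.2⟩).hasDerivWithinAt
  have h1 : Filter.Tendsto F (nhdsWithin 0 (Ioo 0 (π / 8))) (nhds (F 0)) :=
    (hcont 0 ⟨le_rfl, by positivity⟩).mono_left (nhdsWithin_mono _ Ioo_subset_Icc_self)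
  have h3 : Filter.Tendsto F (nhdsWithin 0 (Ioo 0 (π / 8))) (nhds (F (π / 8))) := by
    refine tendsto_const_nhds.congr' ?_
    filter_upwards [self_mem_nhdsWithin] with a ha
    exact (hconst a ha).symm
  have : (nhdsWithin (0:ℝ) (Ioo 0 (π / 8))).NeBot := by
    rw [nhdsWithin_Ioo_eq_nhdsGT (by positivity)]; infer_instance
  exact tendsto_nhds_unique h3 h1

lemma stb_expm1 (w : ℂ) (hw : w.re ≤ 0) : ‖Complex.exp w - 1‖ ≤ 2 * ‖w‖ := by
  by_cases h : ‖w‖ ≤ 1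
  · exact Complex.norm_exp_sub_one_le h
  · push Not at h
    refine (norm_sub_le _ _).trans ?_
    rw [Complex.norm_exp, norm_one]
    have := Real.exp_le_one_iff.mpr hw
    linarith

/-- Value of the integral up to an error of the right order. -/
lemma stb_main (α x : ℝ) (n : ℕ) (h0 : 0 < α) (h2 : α ≤ 2) (hx : 0 < x) :
    ‖(∫ r in Ioi (0:ℝ), (r : ℂ) ^ n * stbE α x n 0 r)
      - n.factorial / (-(Complex.I * x)) ^ (n + 1)‖
      ≤ 2 * ((1 / (x * Real.sin (π / 8))) ^ (n + α + 1) * Real.Gamma (n + α + 1)) := by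
  have hpi := Real.pi_pos
  have hsin : 0 < Real.sin (π / 8) := Real.sin_pos_of_pos_of_lt_pi (by positivity) (by linarith)
  have hn : (0:ℝ) ≤ n := n.cast_nonneg
  rw [← stb_rotate α x n h0 h2 hx.le]
  set q : ℂ := Complex.exp (Complex.I * ((π / 8 : ℝ) : ℂ)) with hq
  have hq0 : q ≠ 0 := Complex.exp_ne_zero _
  set z : ℂ := -(Complex.I * x * q) with hz
  have hzre : z.re = x * Real.sin (π / 8) := by
    have : z = ((-x : ℝ) : ℂ) * (Complex.I * q) := by rw [hz]; push_cast; ring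
    rw [this, Complex.re_ofReal_mul, Complex.I_mul_re, hq, stb_im]; ring
  have hzpos : 0 < z.re := by rw [hzre]; positivity
  have hlap : ∫ r in Ioi (0:ℝ), q ^ (n + 1) * ((r : ℂ) ^ n * Complex.exp (-z * r))
      = n.factorial / (-(Complex.I * x)) ^ (n + 1) := by
    rw [integral_const_mul, stb_laplace z hzpos n]
    have : z = -(Complex.I * x) * q := by rw [hz]; ring
    rw [this, mul_pow]
    have hx' : (x:ℂ) ≠ 0 := by exact_mod_cast hx.ne'
    have hh : -(Complex.I * (x:ℂ)) ≠ 0 := neg_ne_zero.mpr (mul_ne_zero Complex.I_ne_zero hx')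
    field_simp
  rw [← hlap, ← integral_sub (stb_integrable α x n _ h0 h2 hx.le (by positivity) le_rfl)
    ((stb_laplace_int z hzpos n).const_mul _)]
  have hgam := Real.integral_rpow_mul_exp_neg_mul_Ioi (a := n + α + 1)
    (r := x * Real.sin (π / 8)) (by linarith) (by positivity)
  rw [← hgam, ← integral_const_mul]
  refine norm_integral_le_of_norm_le ?_ ?_
  · refine Integrable.const_mul ?_ 2
    have := stb_int 1 (x * Real.sin (π / 8)) one_pos (by positivity) (n + α + 1 - 1) (by linarith)
    simpa [IntegrableOn] using this
  · filter_upwards [ae_restrict_mem measurableSet_Ioi] with r hr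
    have hr : 0 < r := hr
    set w : ℂ := -(((r ^ α : ℝ) : ℂ) * Complex.exp (Complex.I * (α * ((π / 8 : ℝ) : ℂ)))) with hw
    have hE : (r : ℂ) ^ n * stbE α x n (π / 8) r - q ^ (n + 1) * ((r : ℂ) ^ n * Complex.exp (-z * r))
        = (r : ℂ) ^ n * q ^ (n + 1) * Complex.exp (-z * r) * (Complex.exp w - 1) := by
      have : stbE α x n (π / 8) r = q ^ (n + 1) * Complex.exp (-z * r) * Complex.exp w := by
        unfold stbE
        rw [hq, ← Complex.exp_nat_mul, ← Complex.exp_add, ← Complex.exp_add]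
        congr 1
        rw [hw, hz, hq]
        push_cast
        ring
      rw [this]; ring
    have hwn : ‖w‖ = r ^ α := by
      rw [hw, norm_neg, norm_mul, stb_nrm', mul_one, Complex.norm_real,
        Real.norm_of_nonneg (by positivity)]
    have hwre : w.re ≤ 0 := by
      have h1 := stb_re (α * (π / 8))
      rw [Complex.ofReal_mul] at h1
      rw [hw, Complex.neg_re, Complex.re_ofReal_mul, h1]
      have h3 := stb_cos α (π / 8) h0 h2 (by positivity) le_rfl
      have h4 := stb_cpos
      have h5 : 0 ≤ r ^ α := by positivity
      have : 0 ≤ r ^ α * Real.cos (α * (π / 8)) := mul_nonneg h5 (h4.le.trans h3)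
      linarith
    rw [hE, norm_mul, norm_mul, norm_mul, norm_pow, norm_pow, hq, stb_nrm, one_pow, mul_one,
      Complex.norm_real, Real.norm_of_nonneg hr.le, Complex.norm_exp]
    have hre : (-z * (r:ℂ)).re = -(x * Real.sin (π / 8) * r) := by
      rw [Complex.re_mul_ofReal, Complex.neg_re, hzre]; ring
    rw [hre]
    calc r ^ n * Real.exp (-(x * Real.sin (π / 8) * r)) * ‖Complex.exp w - 1‖
        ≤ r ^ n * Real.exp (-(x * Real.sin (π / 8) * r)) * (2 * r ^ α) := by
          gcongr
          rw [← hwn]; exact stb_expm1 w hwre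
      _ = 2 * (r ^ ((n:ℝ) + α + 1 - 1) * Real.exp (-(x * Real.sin (π / 8) * r))) := by
          rw [add_sub_cancel_right, Real.rpow_add hr, Real.rpow_natCast]; ring

/-- The candidate for the `n`-th derivative (times `π`). -/
noncomputable def stbD (α : ℝ) (n : ℕ) (x : ℝ) : ℝ :=
  ∫ u in Ioi (0:ℝ), Real.cos (u * x + n * (π / 2)) * (u ^ n * Real.exp (-(u ^ α)))

lemma stb_int1 (α : ℝ) (h0 : 0 < α) (n : ℕ) :
    IntegrableOn (fun r : ℝ => r ^ n * Real.exp (-(r ^ α))) (Ioi 0) := by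
  simpa using stb_int_nat α 1 h0 one_pos n

lemma stb_intD (α : ℝ) (h0 : 0 < α) (n : ℕ) (x : ℝ) :
    IntegrableOn (fun u : ℝ => Real.cos (u * x + n * (π / 2)) * (u ^ n * Real.exp (-(u ^ α))))
      (Ioi 0) := by
  refine Integrable.mono' (stb_int1 α h0 n)
    (Measurable.aestronglyMeasurable (by fun_prop)) ?_
  filter_upwards [ae_restrict_mem measurableSet_Ioi] with r hr
  have hr : 0 < r := hr
  rw [norm_mul, Real.norm_of_nonneg (by positivity : 0 ≤ r ^ n * Real.exp (-(r ^ α)))]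
  exact mul_le_of_le_one_left (by positivity) (Real.abs_cos_le_one _)

lemma stb_derivD (α : ℝ) (h0 : 0 < α) (n : ℕ) (x : ℝ) :
    HasDerivAt (stbD α n) (stbD α (n + 1) x) x := by
  refine (hasDerivAt_integral_of_dominated_loc_of_deriv_le (μ := volume.restrict (Ioi (0:ℝ)))
      (F := fun x u => Real.cos (u * x + n * (π / 2)) * (u ^ n * Real.exp (-(u ^ α))))
      (F' := fun x u => Real.cos (u * x + (n + 1 : ℕ) * (π / 2)) *
        (u ^ (n + 1) * Real.exp (-(u ^ α))))
      (bound := fun r => r ^ (n + 1) * Real.exp (-(r ^ α)))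
      (s := univ) Filter.univ_mem ?_ (stb_intD α h0 n x) ?_ ?_ (stb_int1 α h0 (n + 1)) ?_).2
  · exact Filter.Eventually.of_forall fun t => (stb_intD α h0 n t).aestronglyMeasurable
  · exact (stb_intD α h0 (n + 1) x).aestronglyMeasurable
  · filter_upwards [ae_restrict_mem measurableSet_Ioi] with r hr t _
    have hr : 0 < r := hr
    rw [norm_mul, Real.norm_of_nonneg (by positivity : 0 ≤ r ^ (n + 1) * Real.exp (-(r ^ α)))]
    exact mul_le_of_le_one_left (by positivity) (Real.abs_cos_le_one _)
  · refine Filter.Eventually.of_forall fun r t _ => ?_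
    have h1 : HasDerivAt (fun t : ℝ => r * t + n * (π / 2)) (r * 1) t :=
      ((hasDerivAt_id t).const_mul r).add_const _
    refine (h1.cos.mul_const _).congr_deriv ?_
    have : r * t + ((n + 1 : ℕ) : ℝ) * (π / 2) = r * t + n * (π / 2) + π / 2 := by push_cast; ring
    rw [this, Real.cos_add_pi_div_two]
    ring

lemma stb_D_eq (α x : ℝ) (n : ℕ) (h0 : 0 < α) (h2 : α ≤ 2) (hx : 0 < x) :
    stbD α n x = (Complex.I ^ n * ∫ r in Ioi (0:ℝ), (r : ℂ) ^ n * stbE α x n 0 r).re := by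
  rw [← integral_const_mul]
  have hi := (stb_integrable α x n 0 h0 h2 hx.le le_rfl (by positivity)).const_mul (Complex.I ^ n)
  rw [← RCLike.re_eq_complex_re, ← integral_re hi]
  unfold stbD
  refine setIntegral_congr_fun measurableSet_Ioi fun r hr => ?_
  have hI : Complex.I ^ n = Complex.exp (n * (π / 2 * Complex.I)) := by
    rw [Complex.exp_nat_mul, Complex.exp_pi_div_two_mul_I]
  have : Complex.I ^ n * ((r : ℂ) ^ n * stbE α x n 0 r)
      = ((r ^ n * Real.exp (-(r ^ α)) : ℝ) : ℂ)
        * Complex.exp (((r * x + n * (π / 2) : ℝ) : ℂ) * Complex.I) := by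
    unfold stbE
    rw [hI]
    push_cast
    have e : ∀ a b c d : ℂ, a + b = c + d →
      Complex.exp a * ((r:ℂ) ^ n * Complex.exp b) = (r:ℂ) ^ n * Complex.exp c * Complex.exp d := by
      intro a b c d h
      rw [mul_assoc, ← Complex.exp_add, ← h, Complex.exp_add]; ring
    apply e
    simp
    ring
  simp only [RCLike.re_eq_complex_re]
  rw [this, Complex.re_ofReal_mul, Complex.exp_ofReal_mul_I_re, mul_comm]

lemma stb_D_bound (α x : ℝ) (n : ℕ) (h0 : 0 < α) (h2 : α ≤ 2) (hx : 0 < x) :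
    |stbD α n x| ≤ 2 * ((1 / (x * Real.sin (π / 8))) ^ (n + α + 1) * Real.Gamma (n + α + 1)) := by
  refine le_trans ?_ (stb_main α x n h0 h2 hx)
  rw [stb_D_eq α x n h0 h2 hx]
  set J := ∫ r in Ioi (0:ℝ), (r : ℂ) ^ n * stbE α x n 0 r
  have hz : (Complex.I ^ n * (n.factorial / (-(Complex.I * x)) ^ (n + 1))).re = 0 := by
    have : Complex.I ^ n * (n.factorial / (-(Complex.I * x)) ^ (n + 1))
        = (((-1) ^ n * n.factorial / x ^ (n + 1) : ℝ) : ℂ) * Complex.I := by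
      have hinv : (-(Complex.I * (x:ℂ)))⁻¹ = Complex.I * (x:ℂ)⁻¹ := by
        rw [inv_neg, mul_inv, Complex.inv_I]; ring
      rw [div_eq_mul_inv, ← inv_pow, hinv, mul_pow]
      push_cast
      rw [div_eq_mul_inv, ← inv_pow, pow_succ Complex.I n, ← Complex.I_sq, ← pow_mul]
      ring
    rw [this, Complex.re_ofReal_mul, Complex.I_re, mul_zero]
  have : (Complex.I ^ n * J).re
      = (Complex.I ^ n * (J - n.factorial / (-(Complex.I * x)) ^ (n + 1))).re := by
    rw [mul_sub, Complex.sub_re, hz, sub_zero]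
  rw [this]
  refine (Complex.abs_re_le_norm _).trans ?_
  rw [norm_mul, norm_pow, Complex.norm_I, one_pow, one_mul]

theorem smalltime_thm53 (α : ℝ) (h0 : 0 < α) (h2 : α ≤ 2)
    (p₁ : ℝ → ℝ)
    (hp : ∀ x : ℝ, p₁ x = (1 / π) * ∫ u in Ioi (0:ℝ), Real.cos (u * x) * Real.exp (-(u ^ α))) :
    ContDiff ℝ (⊤ : ℕ∞) p₁ ∧
    ∀ n : ℕ, ∀ ε : ℝ, 0 < ε → ∃ c : ℝ, ∀ x : ℝ, ε < |x| →
      |x| ^ (α + 1 + n) * |iteratedDeriv n p₁ x| ≤ c := by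
  have hpi := Real.pi_pos
  have hiter : ∀ n : ℕ, iteratedDeriv n p₁ = fun x => (1 / π) * stbD α n x := by
    intro n
    induction n with
    | zero =>
      funext x
      simp [hp, stbD]
    | succ m ih =>
      funext x
      rw [iteratedDeriv_succ, ih]
      exact ((stb_derivD α h0 m x).const_mul _).deriv
  have heven : (fun x => p₁ (-x)) = p₁ := by
    funext x
    simp [hp]
  have habs : ∀ (n : ℕ) (x : ℝ), |iteratedDeriv n p₁ (-x)| = |iteratedDeriv n p₁ x| := by
    intro n x
    have := iteratedDeriv_comp_neg n p₁ x
    rw [heven] at this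
    rw [this]
    simp [abs_mul]
  refine ⟨contDiff_of_differentiable_iteratedDeriv fun m _ => ?_, fun n ε hε => ?_⟩
  · rw [hiter]
    exact fun x => ((stb_derivD α h0 m x).const_mul _).differentiableAt
  · have hsin : 0 < Real.sin (π / 8) := Real.sin_pos_of_pos_of_lt_pi (by positivity) (by linarith)
    refine ⟨(1 / π) * (2 * ((1 / Real.sin (π / 8)) ^ (n + α + 1) * Real.Gamma (n + α + 1))),
      fun x hx => ?_⟩
    have hx0 : 0 < |x| := hε.trans hx
    have h1 : |iteratedDeriv n p₁ x| = |iteratedDeriv n p₁ (|x|)| := by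
      rcases abs_choice x with h | h
      · rw [h]
      · rw [h, habs]
    rw [h1, hiter, abs_mul, abs_of_pos (by positivity : 0 < 1 / π)]
    have hb := stb_D_bound α (|x|) n h0 h2 hx0
    rw [← div_div, div_eq_mul_one_div (1 / |x|), Real.mul_rpow (by positivity) (by positivity),
      Real.div_rpow zero_le_one hx0.le, Real.one_rpow] at hb
    have he : α + 1 + (n:ℝ) = n + α + 1 := by ring
    rw [he]
    have hpos : 0 < |x| ^ ((n:ℝ) + α + 1) := by positivity
    calc |x| ^ ((n:ℝ) + α + 1) * (1 / π * |stbD α n (|x|)|)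
        ≤ |x| ^ ((n:ℝ) + α + 1) * (1 / π * (2 * (1 / |x| ^ ((n:ℝ) + α + 1)
          * (1 / Real.sin (π / 8)) ^ ((n:ℝ) + α + 1) * Real.Gamma (n + α + 1)))) := by
          gcongr
      _ = _ := by
          field_simp
end

section
/- Let 0 < α ≤ 2 and for t > 0 define p_t : ℝ → ℝ by p_t(x) = (1/π) ∫₀^∞ cos(ux) e^{−t u^α} du. Then for every integer n ≥ 0 and every ε > 0 there exists a constant c_{n,ε} < ∞ such that for all t with 0 < t ≤ 1 and all x with |x| > ε, |p_t^{(n)}(x)| ≤ c_{n,ε} · t, where p_t^{(n)} denotes the n-th derivative of x ↦ p_t(x). -/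
open MeasureTheory Real Set

open Filter Topology

lemma aux_norm_exp_sub_one {z : ℂ} (hz : z.re ≤ 0) : ‖Complex.exp z - 1‖ ≤ ‖z‖ := by
  have h := (convex_halfSpace_re_le (0:ℝ)).norm_image_sub_le_of_norm_hasDerivWithin_le
    (f := Complex.exp) (f' := Complex.exp) (C := 1) (x := 0) (y := z)
    (fun w _ => (Complex.hasDerivAt_exp w).hasDerivWithinAt)
    (fun w hw => by
      rw [Complex.norm_exp]
      exact Real.exp_le_one_iff.2 hw) (by simp) hz
  simpa using h

noncomputable def auxPhi (α t x θ s : ℝ) : ℂ :=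
  Complex.I * s * x * Complex.exp (θ * Complex.I)
    - t * ((s ^ α : ℝ) : ℂ) * Complex.exp ((α * θ : ℝ) * Complex.I)

lemma auxPhi_re (α t x θ s : ℝ) :
    (auxPhi α t x θ s).re = -(s * x * Real.sin θ) - t * s ^ α * Real.cos (α * θ) := by
  have h1 : auxPhi α t x θ s = ((s * x : ℝ) : ℂ) * (Complex.I * Complex.exp (θ * Complex.I))
    - ((t * s ^ α : ℝ) : ℂ) * Complex.exp ((α * θ : ℝ) * Complex.I) := by
    unfold auxPhi; push_cast; ring
  rw [h1, Complex.sub_re, Complex.re_ofReal_mul, Complex.re_ofReal_mul,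
    Complex.exp_ofReal_mul_I_re, Complex.I_mul_re, Complex.exp_ofReal_mul_I_im]
  ring

lemma aux_angle {α θ : ℝ} (h0 : 0 < α) (h2 : α ≤ 2) (hθ : θ ∈ Icc 0 (π/6)) :
    1/2 ≤ Real.cos (α * θ) ∧ 0 ≤ Real.sin θ := by
  have hp := Real.pi_pos
  constructor
  · rw [← Real.cos_pi_div_three]
    apply Real.cos_le_cos_of_nonneg_of_le_pi
    · exact mul_nonneg h0.le hθ.1
    · linarith
    · nlinarith [hθ.1, hθ.2]
  · exact Real.sin_nonneg_of_nonneg_of_le_pi hθ.1 (by linarith [hθ.2])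

lemma aux_norm_exp_Phi {α t x θ s : ℝ} (h0 : 0 < α) (h2 : α ≤ 2) (ht : 0 < t) (hx : 0 < x)
    (hθ : θ ∈ Icc 0 (π/6)) (hs : 0 < s) :
    ‖Complex.exp (auxPhi α t x θ s)‖ ≤ Real.exp (-(t/2) * s ^ α) := by
  rw [Complex.norm_exp, auxPhi_re]
  obtain ⟨h3, h4⟩ := aux_angle h0 h2 hθ
  apply Real.exp_le_exp.2
  have := mul_nonneg (mul_pos hs hx).le h4
  have h5 : 0 < t * s ^ α := mul_pos ht (Real.rpow_pos_of_pos hs _)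
  nlinarith

/-- the common derivative -/
noncomputable def auxD (α t x θ s : ℝ) : ℂ :=
  Complex.I * Complex.exp (θ * Complex.I) *
    (1 + (Complex.I * s * x * Complex.exp (θ * Complex.I)
      - α * t * ((s ^ α : ℝ) : ℂ) * Complex.exp ((α * θ : ℝ) * Complex.I))) *
    Complex.exp (auxPhi α t x θ s)

lemma aux_deriv_theta (α t x s θ : ℝ) :
    HasDerivAt (fun θ : ℝ => Complex.exp (θ * Complex.I) * Complex.exp (auxPhi α t x θ s))
      (auxD α t x θ s) θ := by
  have h1 : HasDerivAt (fun θ : ℝ => Complex.exp (θ * Complex.I))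
      (Complex.exp (θ * Complex.I) * (1 * Complex.I)) θ :=
    ((Complex.ofRealCLM.hasDerivAt (x := θ)).mul_const Complex.I).cexp
  have h2 : HasDerivAt (fun θ : ℝ => Complex.exp ((α * θ : ℝ) * Complex.I))
      (Complex.exp ((α * θ : ℝ) * Complex.I) * ((α:ℂ) * Complex.I)) θ := by
    have h := ((hasDerivAt_id θ).const_mul α).ofReal_comp.mul_const Complex.I |>.cexp
    simpa using h
  have h3 : HasDerivAt (fun θ : ℝ => auxPhi α t x θ s) _ θ :=
    (h1.const_mul (Complex.I * s * x)).sub (h2.const_mul (t * ((s ^ α : ℝ) : ℂ)))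
  refine (h1.mul h3.cexp).congr_deriv ?_
  unfold auxD
  ring

lemma aux_deriv_s (α t x θ : ℝ) {s : ℝ} (hs : 0 < s) :
    HasDerivAt (fun s : ℝ => Complex.I * s * Complex.exp (θ * Complex.I)
        * Complex.exp (auxPhi α t x θ s))
      (auxD α t x θ s) s := by
  have h0 : HasDerivAt (fun s : ℝ => (s:ℂ)) 1 s := Complex.ofRealCLM.hasDerivAt
  have h1 := (h0.const_mul Complex.I)
  have h2 : HasDerivAt (fun s : ℝ => ((s ^ α : ℝ) : ℂ)) ((α * s ^ (α - 1) : ℝ) : ℂ) s :=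
    (Real.hasDerivAt_rpow_const (Or.inl hs.ne')).ofReal_comp
  have h3 : HasDerivAt (fun s : ℝ => auxPhi α t x θ s) _ s :=
    ((h1.mul_const (x:ℂ)).mul_const (Complex.exp (θ * Complex.I))).sub
      ((h2.const_mul (t:ℂ)).mul_const (Complex.exp ((α * θ : ℝ) * Complex.I)))
  refine ((h1.mul_const (Complex.exp (θ * Complex.I))).mul h3.cexp).congr_deriv ?_
  have h4 : ((s ^ α : ℝ) : ℂ) = s * ((s ^ (α - 1) : ℝ) : ℂ) := by
    rw [← Complex.ofReal_mul]
    congr 1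
    rw [Real.rpow_sub_one hs.ne']; field_simp
  unfold auxD
  rw [h4]
  push_cast
  ring

lemma aux_integrable {α t : ℝ} (h0 : 0 < α) (ht : 0 < t) (r : ℝ) (hr : 0 ≤ r) :
    IntegrableOn (fun s : ℝ => s ^ r * Real.exp (-(t/2) * s ^ α)) (Ioi 0) :=
  integrableOn_rpow_mul_exp_neg_mul_rpow (by linarith) h0 (by linarith)

lemma aux_bound_integrable {α t : ℝ} (x : ℝ) (h0 : 0 < α) (ht : 0 < t) :
    IntegrableOn (fun s : ℝ => (1 + (s * x + α * t * s ^ α)) * Real.exp (-(t/2) * s ^ α))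
      (Ioi 0) := by
  have h1 := aux_integrable h0 ht 0 le_rfl
  have h2 := (aux_integrable h0 ht 1 zero_le_one).const_mul x
  have h3 := (aux_integrable h0 ht α h0.le).const_mul (α * t)
  refine ((h1.add (h2.add h3))).congr_fun (fun s _ => ?_) measurableSet_Ioi
  simp only [Pi.add_apply, Real.rpow_zero, Real.rpow_one]
  ring

lemma aux_D_bound {α t x θ s : ℝ} (h0 : 0 < α) (h2 : α ≤ 2) (ht : 0 < t) (hx : 0 < x)
    (hθ : θ ∈ Icc 0 (π/6)) (hs : 0 < s) :
    ‖auxD α t x θ s‖ ≤ (1 + (s * x + α * t * s ^ α)) * Real.exp (-(t/2) * s ^ α) := by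
  unfold auxD
  rw [norm_mul, norm_mul, norm_mul, Complex.norm_I, Complex.norm_exp_ofReal_mul_I, one_mul,
    one_mul]
  apply mul_le_mul _ (aux_norm_exp_Phi h0 h2 ht hx hθ hs) (norm_nonneg _) (by positivity)
  refine (norm_add_le _ _).trans ?_
  rw [norm_one]
  gcongr
  refine (norm_sub_le _ _).trans ?_
  rw [norm_mul, norm_mul _ (Complex.exp _), Complex.norm_exp_ofReal_mul_I,
    Complex.norm_exp_ofReal_mul_I]
  have : 0 < s ^ α := Real.rpow_pos_of_pos hs _
  simp [abs_of_pos, *]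

lemma aux_cont_g (α t x θ : ℝ) : ContinuousOn (fun s : ℝ => auxPhi α t x θ s) (Ioi 0) := by
  have h : ContinuousOn (fun s : ℝ => ((s ^ α : ℝ) : ℂ)) (Ioi 0) :=
    Complex.continuous_ofReal.comp_continuousOn
      (continuousOn_id.rpow_const (fun s hs => Or.inl (ne_of_gt hs)))
  unfold auxPhi
  fun_prop

lemma aux_cont_D (α t x θ : ℝ) : ContinuousOn (fun s : ℝ => auxD α t x θ s) (Ioi 0) := by
  have h : ContinuousOn (fun s : ℝ => ((s ^ α : ℝ) : ℂ)) (Ioi 0) :=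
    Complex.continuous_ofReal.comp_continuousOn
      (continuousOn_id.rpow_const (fun s hs => Or.inl (ne_of_gt hs)))
  have := aux_cont_g α t x θ
  unfold auxD
  fun_prop

lemma aux_cont_F (α t x θ : ℝ) : ContinuousOn (fun s : ℝ =>
    Complex.exp (θ * Complex.I) * Complex.exp (auxPhi α t x θ s)) (Ioi 0) := by
  have := aux_cont_g α t x θ
  fun_prop

lemma aux_int_D {α t x θ : ℝ} (h0 : 0 < α) (h2 : α ≤ 2) (ht : 0 < t) (hx : 0 < x)
    (hθ : θ ∈ Icc 0 (π/6)) : ∫ s in Ioi (0:ℝ), auxD α t x θ s = 0 := by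
  have hint : IntegrableOn (fun s => auxD α t x θ s) (Ioi 0) := by
    refine (aux_bound_integrable x h0 ht).mono'
      ((aux_cont_D α t x θ).aestronglyMeasurable measurableSet_Ioi) ?_
    filter_upwards [ae_restrict_mem measurableSet_Ioi] with s hs
    exact aux_D_bound h0 h2 ht hx hθ hs
  have key : ∀ s : ℝ, 0 < s → ‖Complex.I * s * Complex.exp (θ * Complex.I)
        * Complex.exp (auxPhi α t x θ s)‖ ≤ s * Real.exp (-(t/2) * s ^ α) := by
    intro s hs
    rw [norm_mul, norm_mul, norm_mul, Complex.norm_I, Complex.norm_exp_ofReal_mul_I, one_mul,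
      mul_one, Complex.norm_real, Real.norm_of_nonneg hs.le]
    exact mul_le_mul_of_nonneg_left (aux_norm_exp_Phi h0 h2 ht hx hθ hs) hs.le
  have hlim : Tendsto (fun s : ℝ => s * Real.exp (-(t/2) * s ^ α)) atTop (𝓝 0) := by
    have h := (tendsto_rpow_mul_exp_neg_mul_atTop_nhds_zero (1/α) (t/2) (by linarith)).comp
      (tendsto_rpow_atTop h0)
    refine h.congr' ?_
    filter_upwards [eventually_gt_atTop 0] with s hs
    simp only [Function.comp]
    rw [← Real.rpow_mul hs.le, mul_one_div_cancel h0.ne', Real.rpow_one]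
  have := integral_Ioi_of_hasDerivAt_of_tendsto (a := (0:ℝ)) (m := (0:ℂ))
    (f := fun s : ℝ => Complex.I * s * Complex.exp (θ * Complex.I)
        * Complex.exp (auxPhi α t x θ s)) (f' := fun s => auxD α t x θ s) ?_
    (fun s hs => aux_deriv_s α t x θ hs) hint ?_
  · rw [this]; simp
  · have h : Continuous (fun s : ℝ => ((s ^ α : ℝ) : ℂ)) :=
      Complex.continuous_ofReal.comp (Real.continuous_rpow_const h0.le)
    apply Continuous.continuousWithinAt
    unfold auxPhi
    fun_prop
  · apply squeeze_zero_norm' _ hlim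
    filter_upwards [eventually_gt_atTop 0] with s hs using key s hs

/-- rotation of the contour -/
lemma aux_rotate {α t x : ℝ} (h0 : 0 < α) (h2 : α ≤ 2) (ht : 0 < t) (hx : 0 < x) :
    ∫ s in Ioi (0:ℝ), Complex.exp ((π/6 : ℝ) * Complex.I) * Complex.exp (auxPhi α t x (π/6) s)
     = ∫ s in Ioi (0:ℝ), Complex.exp ((0 : ℝ) * Complex.I) * Complex.exp (auxPhi α t x 0 s) := by
  set F : ℝ → ℂ := fun θ => ∫ s in Ioi (0:ℝ), Complex.exp (θ * Complex.I)
    * Complex.exp (auxPhi α t x θ s) with hF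
  have hpi := Real.pi_pos
  have hb0 : IntegrableOn (fun s : ℝ => Real.exp (-(t/2) * s ^ α)) (Ioi 0) := by
    simpa using aux_integrable h0 ht 0 le_rfl
  have hFb : ∀ θ ∈ Icc 0 (π/6), ∀ s : ℝ, 0 < s → ‖Complex.exp (θ * Complex.I)
    * Complex.exp (auxPhi α t x θ s)‖ ≤ Real.exp (-(t/2) * s ^ α) := by
    intro θ hθ s hs
    rw [norm_mul, Complex.norm_exp_ofReal_mul_I, one_mul]
    exact aux_norm_exp_Phi h0 h2 ht hx hθ hs
  have hcont : ContinuousOn F (Icc 0 (π/6)) := by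
    apply continuousOn_of_dominated (bound := fun s : ℝ => Real.exp (-(t/2) * s ^ α))
    · intro θ _
      exact (aux_cont_F α t x θ).aestronglyMeasurable measurableSet_Ioi
    · intro θ hθ
      filter_upwards [ae_restrict_mem measurableSet_Ioi] with s hs using hFb θ hθ s hs
    · exact hb0
    · exact Eventually.of_forall fun s θ _ =>
        (aux_deriv_theta α t x s θ).continuousAt.continuousWithinAt
  have hder : ∀ θ ∈ Ioo 0 (π/6), HasDerivAt F 0 θ := by
    intro θ hθ
    have h := hasDerivAt_integral_of_dominated_loc_of_deriv_le (𝕜 := ℝ)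
      (μ := volume.restrict (Ioi (0:ℝ))) (s := Ioo 0 (π/6)) (x₀ := θ)
      (F := fun θ s => Complex.exp (θ * Complex.I) * Complex.exp (auxPhi α t x θ s))
      (F' := fun θ s => auxD α t x θ s)
      (bound := fun s : ℝ => (1 + (s * x + α * t * s ^ α)) * Real.exp (-(t/2) * s ^ α))
      (Ioo_mem_nhds hθ.1 hθ.2)
      (Eventually.of_forall fun θ =>
        (aux_cont_F α t x θ).aestronglyMeasurable measurableSet_Ioi)
      (by
        refine Integrable.mono' hb0
          ((aux_cont_F α t x θ).aestronglyMeasurable measurableSet_Ioi) ?_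
        filter_upwards [ae_restrict_mem measurableSet_Ioi] with s hs
          using hFb θ (Ioo_subset_Icc_self hθ) s hs)
      ((aux_cont_D α t x θ).aestronglyMeasurable measurableSet_Ioi)
      (by
        filter_upwards [ae_restrict_mem measurableSet_Ioi] with s hs
        intro θ hθ
        exact aux_D_bound h0 h2 ht hx (Ioo_subset_Icc_self hθ) hs)
      (aux_bound_integrable x h0 ht)
      (Eventually.of_forall fun s θ _ => aux_deriv_theta α t x s θ)
    have h' := h.2
    rw [aux_int_D h0 h2 ht hx (Ioo_subset_Icc_self hθ)] at h'
    exact h'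
  have hconst : ∀ a ∈ Ioo 0 (π/6), F (π/6) = F a := by
    intro a ha
    exact constant_of_has_deriv_right_zero (hcont.mono (Icc_subset_Icc_left ha.1.le))
      (fun θ hθ => (hder θ ⟨ha.1.trans_le hθ.1, hθ.2⟩).hasDerivWithinAt) _
      (right_mem_Icc.2 ha.2.le)
  have hl : Tendsto F (𝓝[Ioo 0 (π/6)] 0) (𝓝 (F 0)) :=
    (hcont 0 (left_mem_Icc.2 (by positivity))).mono_left
      (nhdsWithin_mono _ Ioo_subset_Icc_self)
  have hne : (𝓝[Ioo 0 (π/6)] (0:ℝ)).NeBot := left_nhdsWithin_Ioo_neBot (by positivity)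
  refine tendsto_nhds_unique (f := fun _ => F (π/6)) tendsto_const_nhds (hl.congr' ?_)
  filter_upwards [self_mem_nhdsWithin] with a ha using (hconst a ha).symm

noncomputable def auxW : ℂ := Complex.exp ((π/6 : ℝ) * Complex.I)

noncomputable def auxE (α t s : ℝ) : ℂ :=
  Complex.exp (-(t * ((s ^ α : ℝ) : ℂ) * Complex.exp ((α * (π/6) : ℝ) * Complex.I))) - 1

/-- the integrand of the n-th derivative -/
noncomputable def auxG (α t : ℝ) (n : ℕ) (x s : ℝ) : ℂ :=
  auxW * (Complex.I * s * auxW) ^ n * Complex.exp (x * (Complex.I * s * auxW)) * auxE α t s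

lemma auxW_norm : ‖auxW‖ = 1 := Complex.norm_exp_ofReal_mul_I _

lemma auxW_im : auxW.im = 1/2 := by
  unfold auxW; rw [Complex.exp_ofReal_mul_I_im, Real.sin_pi_div_six]

lemma auxE_norm {α t s : ℝ} (h0 : 0 < α) (h2 : α ≤ 2) (ht : 0 < t) (hs : 0 < s) :
    ‖auxE α t s‖ ≤ t * s ^ α := by
  have hsp : 0 < s ^ α := Real.rpow_pos_of_pos hs _
  have hc := (aux_angle h0 h2 (right_mem_Icc.2 (by positivity : (0:ℝ) ≤ π/6))).1
  refine (aux_norm_exp_sub_one ?_).trans ?_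
  · rw [← Complex.ofReal_mul, Complex.neg_re, Complex.re_ofReal_mul,
      Complex.exp_ofReal_mul_I_re]
    have : 0 < t * s ^ α := by positivity
    nlinarith
  · rw [norm_neg, ← Complex.ofReal_mul, norm_mul, Complex.norm_exp_ofReal_mul_I, mul_one,
      Complex.norm_real, Real.norm_of_nonneg (by positivity)]

lemma aux_exp_re (x s : ℝ) : ‖Complex.exp (x * (Complex.I * s * auxW))‖
    = Real.exp (-(s * x / 2)) := by
  rw [Complex.norm_exp]
  congr 1
  rw [show (x * (Complex.I * s * auxW) : ℂ) = ((x * s : ℝ) : ℂ) * (Complex.I * auxW) by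
    push_cast; ring, Complex.re_ofReal_mul, Complex.I_mul_re, auxW_im]
  ring

lemma auxG_norm {α t s x y : ℝ} (n : ℕ) (h0 : 0 < α) (h2 : α ≤ 2) (ht : 0 < t) (hs : 0 < s)
    (hxy : y ≤ x) :
    ‖auxG α t n x s‖ ≤ t * (s ^ (n + α) * Real.exp (-(y/2) * s ^ (1:ℝ))) := by
  unfold auxG
  rw [norm_mul, norm_mul, norm_mul, norm_pow, norm_mul, norm_mul, auxW_norm, Complex.norm_I,
    aux_exp_re, Complex.norm_real, Real.norm_of_nonneg hs.le, Real.rpow_add hs,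
    Real.rpow_natCast, Real.rpow_one]
  simp only [one_mul, mul_one]
  have h1 := auxE_norm h0 h2 ht hs
  have h3 : Real.exp (-(s * x / 2)) ≤ Real.exp (-(y/2) * s) := by
    apply Real.exp_le_exp.2; nlinarith
  calc s ^ n * Real.exp (-(s * x / 2)) * ‖auxE α t s‖
      ≤ s ^ n * Real.exp (-(y/2) * s) * (t * s ^ α) := by gcongr
    _ = _ := by ring

lemma auxG_cont (α t : ℝ) (n : ℕ) (x : ℝ) : ContinuousOn (fun s => auxG α t n x s) (Ioi 0) := by
  have h : ContinuousOn (fun s : ℝ => ((s ^ α : ℝ) : ℂ)) (Ioi 0) :=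
    Complex.continuous_ofReal.comp_continuousOn
      (continuousOn_id.rpow_const (fun s hs => Or.inl (ne_of_gt hs)))
  unfold auxG auxE
  fun_prop

lemma auxG_bound_int {α : ℝ} (t : ℝ) (n : ℕ) (h0 : 0 < α) {y : ℝ} (hy : 0 < y) :
    IntegrableOn (fun s : ℝ => t * (s ^ (n + α) * Real.exp (-(y/2) * s ^ (1:ℝ)))) (Ioi 0) := by
  have hn : (0:ℝ) ≤ n := n.cast_nonneg
  have h : (-1:ℝ) < n + α := by linarith
  exact (integrableOn_rpow_mul_exp_neg_mul_rpow h one_pos (by linarith)).const_mul t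

lemma auxG_integrable {α t : ℝ} (n : ℕ) (h0 : 0 < α) (h2 : α ≤ 2) (ht : 0 < t) {x : ℝ}
    (hx : 0 < x) : IntegrableOn (fun s => auxG α t n x s) (Ioi 0) := by
  refine (auxG_bound_int t n h0 hx).mono'
      ((auxG_cont α t n x).aestronglyMeasurable measurableSet_Ioi) ?_
  filter_upwards [ae_restrict_mem measurableSet_Ioi] with s hs
  exact auxG_norm n h0 h2 ht hs le_rfl

lemma auxG_deriv {α t : ℝ} (n : ℕ) (h0 : 0 < α) (h2 : α ≤ 2) (ht : 0 < t) {x : ℝ}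
    (hx : 0 < x) : HasDerivAt (fun x => ∫ s in Ioi (0:ℝ), auxG α t n x s)
      (∫ s in Ioi (0:ℝ), auxG α t (n+1) x s) x := by
  refine (hasDerivAt_integral_of_dominated_loc_of_deriv_le (𝕜 := ℝ)
      (μ := volume.restrict (Ioi (0:ℝ))) (s := Ioi (x/2)) (x₀ := x)
      (F := fun x s => auxG α t n x s)
      (F' := fun x s => auxG α t (n+1) x s)
      (bound := fun s : ℝ => t * (s ^ ((n+1:ℕ) + α) * Real.exp (-((x/2)/2) * s ^ (1:ℝ))))
      (Ioi_mem_nhds (by linarith))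
      (Eventually.of_forall fun y =>
        (auxG_cont α t n y).aestronglyMeasurable measurableSet_Ioi)
      (auxG_integrable n h0 h2 ht hx)
      ((auxG_cont α t (n+1) x).aestronglyMeasurable measurableSet_Ioi)
      ?_ (auxG_bound_int t (n+1) h0 (by linarith)) ?_).2
  · filter_upwards [ae_restrict_mem measurableSet_Ioi] with s hs
    intro y hy
    exact auxG_norm (n+1) h0 h2 ht hs (le_of_lt hy)
  · refine Eventually.of_forall fun s y _ => ?_
    have h1 : HasDerivAt (fun y : ℝ => (y:ℂ)) 1 y := Complex.ofRealCLM.hasDerivAt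
    have h3 := (((h1.mul_const (Complex.I * s * auxW)).cexp).const_mul
      (auxW * (Complex.I * s * auxW) ^ n)).mul_const (auxE α t s)
    refine h3.congr_deriv ?_
    unfold auxG
    ring

lemma aux_base {α t : ℝ} (h0 : 0 < α) (h2 : α ≤ 2) (ht : 0 < t) {x : ℝ} (hx : 0 < x) :
    ∫ u in Ioi (0:ℝ), Real.cos (u * x) * Real.exp (-(t * u ^ α))
      = (∫ s in Ioi (0:ℝ), auxG α t 0 x s).re := by
  have hre : (x * (Complex.I * auxW)).re = -(x/2) := by
    rw [Complex.re_ofReal_mul, Complex.I_mul_re, auxW_im]; ring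
  have hneg : (x * (Complex.I * auxW)).re < 0 := by rw [hre]; linarith
  have e1 : ∫ s in Ioi (0:ℝ), auxW * Complex.exp ((x * (Complex.I * auxW)) * s)
      = Complex.I / x := by
    rw [integral_const_mul, integral_exp_mul_complex_Ioi hneg]
    have hw : auxW ≠ 0 := by unfold auxW; exact Complex.exp_ne_zero _
    have hx' : (x:ℂ) ≠ 0 := by exact_mod_cast hx.ne'
    simp
    field_simp
    simp
  have i1 : IntegrableOn (fun s : ℝ => auxW * Complex.exp ((x * (Complex.I * auxW)) * s))
      (Ioi 0) := (integrableOn_exp_mul_complex_Ioi hneg 0).const_mul _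
  have e2 := integral_add (auxG_integrable 0 h0 h2 ht hx) i1
  have e3 : ∀ s : ℝ, auxG α t 0 x s + auxW * Complex.exp ((x * (Complex.I * auxW)) * s)
      = Complex.exp ((π/6 : ℝ) * Complex.I) * Complex.exp (auxPhi α t x (π/6) s) := by
    intro s
    change _ = auxW * _
    have : auxPhi α t x (π/6) s = x * (Complex.I * s * auxW) +
      (-(t * ((s ^ α : ℝ) : ℂ) * Complex.exp ((α * (π/6) : ℝ) * Complex.I))) := by
      unfold auxPhi auxW; ring
    rw [this, Complex.exp_add]
    unfold auxG auxE
    rw [show (x * (Complex.I * auxW) * s : ℂ) = x * (Complex.I * s * auxW) by ring]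
    ring
  simp_rw [e3] at e2
  rw [aux_rotate h0 h2 ht hx, e1] at e2
  have e4 : (∫ s in Ioi (0:ℝ), Complex.exp ((0 : ℝ) * Complex.I)
      * Complex.exp (auxPhi α t x 0 s)).re = (∫ s in Ioi (0:ℝ), auxG α t 0 x s).re := by
    rw [e2]
    simp [Complex.div_ofReal_re]
  rw [← e4]
  have i2 : IntegrableOn (fun s : ℝ => Complex.exp ((0 : ℝ) * Complex.I)
      * Complex.exp (auxPhi α t x 0 s)) (Ioi 0) := by
    have hb0 : IntegrableOn (fun s : ℝ => Real.exp (-(t/2) * s ^ α)) (Ioi 0) := by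
      simpa using aux_integrable h0 ht 0 le_rfl
    refine Integrable.mono' hb0
      ((aux_cont_F α t x 0).aestronglyMeasurable measurableSet_Ioi) ?_
    filter_upwards [ae_restrict_mem measurableSet_Ioi] with s hs
    rw [norm_mul, Complex.norm_exp_ofReal_mul_I, one_mul]
    exact aux_norm_exp_Phi h0 h2 ht hx (left_mem_Icc.2 (by positivity)) hs
  have := integral_re i2
  simp only [RCLike.re_to_complex] at this
  rw [← this]
  congr 1
  ext s
  have hPhi : auxPhi α t x 0 s = ((-(t * s ^ α) : ℝ) : ℂ) + ((s * x : ℝ) : ℂ) * Complex.I := by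
    unfold auxPhi; push_cast; simp; ring
  rw [hPhi, Complex.exp_add, ← Complex.ofReal_exp]
  simp only [Complex.ofReal_zero, zero_mul, Complex.exp_zero, one_mul]
  rw [Complex.re_ofReal_mul, Complex.exp_ofReal_mul_I_re, mul_comm]

theorem smalltime_cor54 (α : ℝ) (h0 : 0 < α) (h2 : α ≤ 2)
    (p : ℝ → ℝ → ℝ)
    (hp : ∀ t : ℝ, 0 < t → ∀ x : ℝ,
      p t x = (1 / π) * ∫ u in Ioi (0:ℝ), Real.cos (u * x) * Real.exp (-(t * u ^ α))) :
    ∀ n : ℕ, ∀ ε : ℝ, 0 < ε → ∃ c : ℝ, ∀ t : ℝ, 0 < t → t ≤ 1 →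
      ∀ x : ℝ, ε < |x| → |iteratedDeriv n (p t) x| ≤ c * t := by
  intro n ε hε
  refine ⟨(1/π) * ∫ s in Ioi (0:ℝ), s ^ (n + α) * Real.exp (-(ε/2) * s ^ (1:ℝ)), ?_⟩
  intro t ht _
  have hit : ∀ n : ℕ, ∀ x : ℝ, 0 < x →
      iteratedDeriv n (p t) x = (1/π) * (∫ s in Ioi (0:ℝ), auxG α t n x s).re := by
    intro n
    induction n with
    | zero =>
      intro x hx
      rw [iteratedDeriv_zero, hp t ht, aux_base h0 h2 ht hx]
    | succ n ih =>
      intro x hx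
      rw [iteratedDeriv_succ]
      have h : iteratedDeriv n (p t) =ᶠ[𝓝 x]
          fun x => (1/π) * (∫ s in Ioi (0:ℝ), auxG α t n x s).re := by
        filter_upwards [Ioi_mem_nhds hx] with y hy using ih y hy
      rw [h.deriv_eq]
      have h3 := Complex.reCLM.hasFDerivAt.comp_hasDerivAt x (auxG_deriv n h0 h2 ht hx)
      exact (h3.const_mul (1/π)).deriv
  have hpos : ∀ x : ℝ, ε < x → |iteratedDeriv n (p t) x| ≤
      (1/π) * (∫ s in Ioi (0:ℝ), s ^ (n + α) * Real.exp (-(ε/2) * s ^ (1:ℝ))) * t := by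
    intro x hx
    rw [hit n x (hε.trans hx), abs_mul, abs_of_pos (by positivity : 0 < 1/π), mul_assoc]
    gcongr
    refine (Complex.abs_re_le_norm _).trans ?_
    rw [mul_comm, ← integral_const_mul]
    refine norm_integral_le_of_norm_le (auxG_bound_int t n h0 hε) ?_
    filter_upwards [ae_restrict_mem measurableSet_Ioi] with s hs
    exact auxG_norm n h0 h2 ht hs hx.le
  intro x hx
  rcases lt_abs.1 hx with h | h
  · exact hpos x h
  · have hev : (fun y => p t (-y)) = p t := by
      ext y; simp [hp t ht]
    have := iteratedDeriv_comp_neg n (p t) x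
    rw [hev] at this
    rw [this, smul_eq_mul, abs_mul, abs_pow, abs_neg, abs_one, one_pow, one_mul]
    exact hpos (-x) h
end

section
/- Let 0 < α ≤ 2 and let γ : ℝ → ℂ be infinitely differentiable. Assume: (i) for every integer i ≥ 1 there exist constants c_i < ∞ and u_{0,i} > 0 such that |γ^{(i)}(u)| ≤ c_i |u|^{α−i} for all |u| > u_{0,i}; and (ii) there exist constants c₀ > 0 and u₀ > 0 such that Re γ(u) ≤ −c₀ |u|^α for all |u| > u₀. For t > 0 define p_t(x) := (1/(2π)) ∫_ℝ e^{−iux} e^{t γ(u)} du. Then each p_t is infinitely differentiable in x, and for every integer m ≥ 0, every ε > 0, and every t₀ > 0, sup_{0 < t ≤ t₀} sup_{|x| > ε} |p_t^{(m)}(x)| < ∞, where p_t^{(m)} denotes the m-th derivative of x ↦ p_t(x). -/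
open MeasureTheory Real Set

lemma aux_leibniz (a b : ℝ → ℂ) (ha : ContDiff ℝ (⊤ : ℕ∞) a) (hb : ContDiff ℝ (⊤ : ℕ∞) b)
    (n : ℕ) (u w : ℝ) (hw : 0 < w) (A B : ℕ → ℝ)
    (hA : ∀ j ≤ n, w ^ j * ‖iteratedDeriv j a u‖ ≤ A j)
    (hB : ∀ j ≤ n, w ^ j * ‖iteratedDeriv j b u‖ ≤ B j) :
    w ^ n * ‖iteratedDeriv n (fun x => a x * b x) u‖ ≤
      ∑ j ∈ Finset.range (n + 1), (n.choose j : ℝ) * A j * B (n - j) := by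
  have hn : ((n : ℕ∞) : WithTop ℕ∞) ≤ ((⊤ : ℕ∞) : WithTop ℕ∞) := by exact_mod_cast le_top
  rw [iteratedDeriv_fun_mul ((ha.of_le hn).contDiffAt) ((hb.of_le hn).contDiffAt)]
  calc _ ≤ w ^ n * ∑ j ∈ Finset.range (n + 1),
        ‖(n.choose j : ℂ) * iteratedDeriv j a u * iteratedDeriv (n - j) b u‖ := by
        gcongr; exact norm_sum_le _ _
    _ = ∑ j ∈ Finset.range (n + 1), (n.choose j : ℝ) * (w ^ j * ‖iteratedDeriv j a u‖) *
          (w ^ (n - j) * ‖iteratedDeriv (n - j) b u‖) := by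
        rw [Finset.mul_sum]
        refine Finset.sum_congr rfl fun j hj => ?_
        have : j ≤ n := by simpa [Nat.lt_succ_iff] using hj
        rw [norm_mul, norm_mul, Complex.norm_natCast]
        nth_rewrite 1 [← Nat.add_sub_cancel' this]
        rw [pow_add]; ring
    _ ≤ _ := by
        refine Finset.sum_le_sum fun j hj => ?_
        have hj : j ≤ n := by simpa [Nat.lt_succ_iff] using hj
        have h1 := hA j hj
        have h2 := hB (n - j) (Nat.sub_le _ _)
        have h3 : 0 ≤ A j := le_trans (by positivity) h1
        gcongr

lemma aux_gamma (α : ℝ) (h0 : 0 < α) (γ : ℝ → ℂ) (hγ : ContDiff ℝ (⊤ : ℕ∞) γ)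
    (hderiv : ∀ i : ℕ, 1 ≤ i → ∃ ci u0i : ℝ, 0 < u0i ∧
      ∀ u : ℝ, u0i < |u| → ‖iteratedDeriv i γ u‖ ≤ ci * |u| ^ (α - (i : ℝ))) (i : ℕ) (hi : 1 ≤ i) :
    ∃ C : ℝ, 0 ≤ C ∧ ∀ u : ℝ, (1 + |u|) ^ i * ‖iteratedDeriv i γ u‖ ≤ C * (1 + |u|) ^ α := by
  obtain ⟨c, r, hr, h⟩ := hderiv i hi
  have hcont : Continuous (fun u : ℝ => (1 + |u|) ^ i * ‖iteratedDeriv i γ u‖) := by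
    have := hγ.continuous_iteratedDeriv i (by exact_mod_cast le_top)
    fun_prop
  obtain ⟨K, hK⟩ := (isCompact_Icc (a := -(r+1)) (b := r+1)).bddAbove_image hcont.continuousOn
  refine ⟨|K| + 2 ^ i * |c|, by positivity, fun u => ?_⟩
  have hw : 1 ≤ 1 + |u| := by linarith [abs_nonneg u]
  have hwa : 1 ≤ (1 + |u|) ^ α := one_le_rpow hw h0.le
  rcases le_or_gt |u| (r + 1) with hu | hu
  · have h1 : (1 + |u|) ^ i * ‖iteratedDeriv i γ u‖ ≤ K := hK ⟨u, abs_le.mp hu, rfl⟩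
    have : 0 ≤ 2 ^ i * |c| := by positivity
    nlinarith [le_abs_self K, abs_nonneg K]
  · have hu0 : 0 < |u| := by linarith
    have h1 := h u (by linarith)
    calc (1 + |u|) ^ i * ‖iteratedDeriv i γ u‖
        ≤ (2 * |u|) ^ i * (|c| * |u| ^ (α - (i : ℝ))) := by
          gcongr
          · linarith
          · exact h1.trans (by gcongr; exact le_abs_self c)
      _ = 2 ^ i * |c| * |u| ^ α := by
          rw [rpow_sub hu0, rpow_natCast, mul_pow]; field_simp
      _ ≤ (|K| + 2 ^ i * |c|) * (1 + |u|) ^ α := by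
          gcongr
          · linarith [abs_nonneg K]
          · linarith

lemma aux_re (α : ℝ) (h0 : 0 < α) (γ : ℝ → ℂ) (hγ : ContDiff ℝ (⊤ : ℕ∞) γ)
    (hre : ∃ c0 u0 : ℝ, 0 < c0 ∧ 0 < u0 ∧
      ∀ u : ℝ, u0 < |u| → (γ u).re ≤ -c0 * |u| ^ α) :
    ∃ A c : ℝ, 0 ≤ A ∧ 0 < c ∧ ∀ u : ℝ, (γ u).re ≤ A - c * (1 + |u|) ^ α := by
  obtain ⟨c, r, hc, hr, h⟩ := hre
  have hcont : Continuous (fun u : ℝ => (γ u).re + c / 2 ^ α * (1 + |u|) ^ α) := by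
    have := hγ.continuous
    have h2 : Continuous (fun u : ℝ => (1 + |u|) ^ α) :=
      Continuous.rpow_const (by fun_prop) (fun _ => Or.inr h0.le)
    fun_prop
  obtain ⟨K, hK⟩ := (isCompact_Icc (a := -(r+1)) (b := r+1)).bddAbove_image hcont.continuousOn
  refine ⟨|K|, c / 2 ^ α, by positivity, by positivity, fun u => ?_⟩
  rcases le_or_gt |u| (r + 1) with hu | hu
  · have h1 : (γ u).re + c / 2 ^ α * (1 + |u|) ^ α ≤ K := hK ⟨u, abs_le.mp hu, rfl⟩
    linarith [le_abs_self K]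
  · have h1 := h u (by linarith)
    have h3 : (1 + |u|) ^ α ≤ 2 ^ α * |u| ^ α := by
      rw [← mul_rpow (by norm_num) (abs_nonneg u)]
      gcongr; linarith
    have h4 : c / 2 ^ α * (1 + |u|) ^ α ≤ c / 2 ^ α * (2 ^ α * |u| ^ α) := by gcongr
    have h5 : c / 2 ^ α * (2 ^ α * |u| ^ α) = c * |u| ^ α := by field_simp
    linarith [abs_nonneg K]

lemma aux_smooth (γ : ℝ → ℂ) (hγ : ContDiff ℝ (⊤ : ℕ∞) γ) (t : ℝ) :
    ContDiff ℝ (⊤ : ℕ∞) (fun u => Complex.exp ((t : ℂ) * γ u)) :=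
  (contDiff_const.mul hγ).cexp

lemma aux_exp (α : ℝ) (h0 : 0 < α) (γ : ℝ → ℂ) (hγ : ContDiff ℝ (⊤ : ℕ∞) γ)
    (hderiv : ∀ i : ℕ, 1 ≤ i → ∃ ci u0i : ℝ, 0 < u0i ∧
      ∀ u : ℝ, u0i < |u| → ‖iteratedDeriv i γ u‖ ≤ ci * |u| ^ (α - (i : ℝ)))
    (hre : ∃ c0 u0 : ℝ, 0 < c0 ∧ 0 < u0 ∧
      ∀ u : ℝ, u0 < |u| → (γ u).re ≤ -c0 * |u| ^ α) (t0 : ℝ) (n : ℕ) :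
    ∀ k : ℕ, ∃ D : ℝ, ∀ t : ℝ, 0 < t → t ≤ t0 → ∀ u : ℝ,
      (1 + |u|) ^ n * ‖iteratedDeriv n (fun u => Complex.exp ((t : ℂ) * γ u)) u‖ ≤
        D / (t * (1 + |u|) ^ α) ^ k := by
  induction n using Nat.strong_induction_on with
  | _ n ih =>
  rcases n with _ | n
  · intro k
    obtain ⟨A, c, hA, hc, h⟩ := aux_re α h0 γ hγ hre
    refine ⟨exp (t0 * A) * (k.factorial / c ^ k), fun t ht htt u => ?_⟩
    set W := (1 + |u|) ^ α with hW
    have hWp : 0 < W := by positivity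
    have hT : 0 < t * W := by positivity
    simp only [pow_zero, one_mul, iteratedDeriv_zero, Complex.norm_exp, Complex.re_ofReal_mul]
    rw [le_div_iff₀ (by positivity)]
    have h1 : t * (γ u).re ≤ t0 * A + -(c * (t * W)) := by
      nlinarith [mul_le_mul_of_nonneg_left (h u) ht.le, mul_le_mul_of_nonneg_right htt hA]
    have h2 := Real.pow_div_factorial_le_exp (x := c * (t * W)) (by positivity) k
    have h3 : exp (-(c * (t * W))) * (t * W) ^ k ≤ k.factorial / c ^ k := by
      rw [exp_neg, ← div_eq_inv_mul, div_le_div_iff₀ (exp_pos _) (by positivity)]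
      rw [div_le_iff₀ (by positivity), mul_pow] at h2
      linarith
    calc exp (t * (γ u).re) * (t * W) ^ k
        ≤ exp (t0 * A + -(c * (t * W))) * (t * W) ^ k := by gcongr
      _ = exp (t0 * A) * (exp (-(c * (t * W))) * (t * W) ^ k) := by rw [exp_add]; ring
      _ ≤ _ := by gcongr
  · intro k
    have hg := fun i => aux_gamma α h0 γ hγ hderiv (i + 1) (by omega)
    choose C hC0 hC using hg
    have : ∀ j, ∃ D : ℝ, j ≤ n → ∀ t : ℝ, 0 < t → t ≤ t0 → ∀ u : ℝ,
      (1 + |u|) ^ j * ‖iteratedDeriv j (fun u => Complex.exp ((t : ℂ) * γ u)) u‖ ≤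
        D / (t * (1 + |u|) ^ α) ^ (k + 1) := by
      intro j
      by_cases hj : j ≤ n
      · obtain ⟨D, hD⟩ := ih j (by omega) (k + 1)
        exact ⟨D, fun _ => hD⟩
      · exact ⟨0, fun h => absurd h hj⟩
    choose D hD using this
    refine ⟨∑ j ∈ Finset.range (n + 1), (n.choose j : ℝ) * C j * D (n - j), fun t ht htt u => ?_⟩
    have hw : 0 < 1 + |u| := by positivity
    have hdγ : ContDiff ℝ (⊤ : ℕ∞) (deriv γ) := (contDiff_infty_iff_deriv.mp hγ).2
    have hd : deriv (fun u => Complex.exp ((t : ℂ) * γ u)) =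
        fun u => ((t : ℂ) * deriv γ u) * Complex.exp ((t : ℂ) * γ u) := by
      funext v
      have hv : HasDerivAt γ (deriv γ v) v :=
        (hγ.differentiable (by simp) v).hasDerivAt
      rw [((hv.const_mul (t : ℂ)).cexp).deriv]; ring
    rw [iteratedDeriv_succ', hd]
    set W := (1 + |u|) ^ α with hW
    have hWp : 0 < W := by positivity
    have key := aux_leibniz (fun u => (t : ℂ) * deriv γ u) (fun u => Complex.exp ((t : ℂ) * γ u))
      (contDiff_const.mul hdγ) (aux_smooth γ hγ t) n u (1 + |u|) hw
      (fun j => C j * (t * W) / (1 + |u|)) (fun j => D j / (t * W) ^ (k + 1))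
      (by
        intro j _
        rw [iteratedDeriv_const_mul_field, ← iteratedDeriv_succ', norm_mul, Complex.norm_real,
          norm_eq_abs, abs_of_pos ht, le_div_iff₀ hw]
        have := mul_le_mul_of_nonneg_left (hC j u) ht.le
        rw [pow_succ] at this
        linarith)
      (fun j hj => hD j hj t ht htt u)
    rw [pow_succ, mul_right_comm]
    calc _ ≤ (∑ j ∈ Finset.range (n + 1), (n.choose j : ℝ) * (C j * (t * W) / (1 + |u|)) *
            (D (n - j) / (t * W) ^ (k + 1))) * (1 + |u|) := by gcongr
      _ = _ := by
        rw [Finset.sum_mul, Finset.sum_div]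
        refine Finset.sum_congr rfl fun j _ => ?_
        field_simp
        ring

lemma aux_poly (m j : ℕ) : ∃ C : ℝ, ∀ u : ℝ,
    (1 + |u|) ^ j * ‖iteratedDeriv j (fun x : ℝ => (-2 * π * Complex.I * x : ℂ) ^ m) u‖
      ≤ C * (1 + |u|) ^ m := by
  have he : (fun x : ℝ => (-2 * π * Complex.I * x : ℂ) ^ m) =
      fun x : ℝ => (x ^ m) • (-2 * π * Complex.I : ℂ) ^ m := by
    funext x
    rw [Complex.real_smul, mul_pow]; push_cast; ring
  refine ⟨m.descFactorial j * ‖(-2 * π * Complex.I : ℂ) ^ m‖, fun u => ?_⟩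
  rw [he, iteratedDeriv_smul_const (by fun_prop), iteratedDeriv_pow, norm_smul, norm_mul, norm_pow,
    norm_eq_abs, norm_eq_abs, Nat.abs_cast]
  rcases le_or_gt j m with h | h
  · have : (1 + |u|) ^ j * |u| ^ (m - j) ≤ (1 + |u|) ^ m := by
      calc _ ≤ (1 + |u|) ^ j * (1 + |u|) ^ (m - j) := by gcongr; linarith
        _ = _ := by rw [← pow_add, Nat.add_sub_cancel' h]
    calc _ = (m.descFactorial j * ‖(-2 * π * Complex.I : ℂ) ^ m‖) *
          ((1 + |u|) ^ j * |u| ^ (m - j)) := by ring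
      _ ≤ _ := by gcongr
  · rw [Nat.descFactorial_eq_zero_iff_lt.mpr h]; simp

lemma aux_g (α : ℝ) (h0 : 0 < α) (γ : ℝ → ℂ) (hγ : ContDiff ℝ (⊤ : ℕ∞) γ)
    (hderiv : ∀ i : ℕ, 1 ≤ i → ∃ ci u0i : ℝ, 0 < u0i ∧
      ∀ u : ℝ, u0i < |u| → ‖iteratedDeriv i γ u‖ ≤ ci * |u| ^ (α - (i : ℝ)))
    (hre : ∃ c0 u0 : ℝ, 0 < c0 ∧ 0 < u0 ∧
      ∀ u : ℝ, u0 < |u| → (γ u).re ≤ -c0 * |u| ^ α) (t0 : ℝ) (m n k : ℕ) :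
    ∃ D : ℝ, ∀ t : ℝ, 0 < t → t ≤ t0 → ∀ u : ℝ,
      (1 + |u|) ^ n * ‖iteratedDeriv n (fun u : ℝ => (-2 * π * Complex.I * u : ℂ) ^ m *
        Complex.exp ((t : ℂ) * γ u)) u‖ ≤
        D * (1 + |u|) ^ m / (t * (1 + |u|) ^ α) ^ k := by
  choose C hC using aux_poly m
  have := fun n => aux_exp α h0 γ hγ hderiv hre t0 n k
  choose D hD using this
  refine ⟨∑ j ∈ Finset.range (n + 1), (n.choose j : ℝ) * C j * D (n - j), fun t ht htt u => ?_⟩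
  have hw : 0 < 1 + |u| := by positivity
  have key := aux_leibniz (fun u : ℝ => (-2 * π * Complex.I * u : ℂ) ^ m)
    (fun u => Complex.exp ((t : ℂ) * γ u))
    ((contDiff_const.mul Complex.ofRealCLM.contDiff).pow m) (aux_smooth γ hγ t) n u (1 + |u|) hw
    (fun j => C j * (1 + |u|) ^ m) (fun j => D j / (t * (1 + |u|) ^ α) ^ k)
    (fun j _ => hC j u) (fun j _ => hD j t ht htt u)
  refine key.trans (le_of_eq ?_)
  rw [Finset.sum_mul, Finset.sum_div]
  refine Finset.sum_congr rfl fun j _ => ?_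
  ring

lemma aux_int2 : Integrable (fun u : ℝ => ((1 + |u|) ^ 2)⁻¹) := by
  have := integrable_one_add_norm (E := ℝ) (μ := volume) (r := 2) (by simp)
  refine this.congr (Filter.Eventually.of_forall fun u => ?_)
  simp only [norm_eq_abs]
  rw [rpow_neg (by positivity)]; norm_cast

lemma aux_gint (α : ℝ) (h0 : 0 < α) (γ : ℝ → ℂ) (hγ : ContDiff ℝ (⊤ : ℕ∞) γ)
    (hderiv : ∀ i : ℕ, 1 ≤ i → ∃ ci u0i : ℝ, 0 < u0i ∧
      ∀ u : ℝ, u0i < |u| → ‖iteratedDeriv i γ u‖ ≤ ci * |u| ^ (α - (i : ℝ)))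
    (hre : ∃ c0 u0 : ℝ, 0 < c0 ∧ 0 < u0 ∧
      ∀ u : ℝ, u0 < |u| → (γ u).re ≤ -c0 * |u| ^ α) (t : ℝ) (ht : 0 < t) (m n : ℕ) :
    Integrable (iteratedDeriv n (fun u : ℝ => (-2 * π * Complex.I * u : ℂ) ^ m *
        Complex.exp ((t : ℂ) * γ u))) := by
  obtain ⟨k, hk⟩ := exists_nat_ge ((m + 2 : ℝ) / α)
  rw [div_le_iff₀ h0] at hk
  obtain ⟨D, hD⟩ := aux_g α h0 γ hγ hderiv hre t m n k
  have hcd : ContDiff ℝ (⊤ : ℕ∞) (fun u : ℝ => (-2 * π * Complex.I * u : ℂ) ^ m *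
        Complex.exp ((t : ℂ) * γ u)) :=
    ((contDiff_const.mul Complex.ofRealCLM.contDiff).pow m).mul (aux_smooth γ hγ t)
  refine (aux_int2.const_mul (|D| / t ^ k)).mono'
    (hcd.continuous_iteratedDeriv n (by exact_mod_cast le_top)).aestronglyMeasurable
    (Filter.Eventually.of_forall fun u => ?_)
  have hw : 1 ≤ 1 + |u| := by linarith [abs_nonneg u]
  have hw0 : 0 < 1 + |u| := by linarith
  have h1 := hD t ht le_rfl u
  have h2 : (1 + |u|) ^ (m + 2) ≤ ((1 + |u|) ^ α) ^ k := by
    rw [← rpow_natCast, ← rpow_natCast, ← rpow_mul hw0.le]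
    apply rpow_le_rpow_of_exponent_le hw
    push_cast; linarith
  calc _ ≤ (1 + |u|) ^ n * ‖iteratedDeriv n (fun u : ℝ => (-2 * π * Complex.I * u : ℂ) ^ m *
        Complex.exp ((t : ℂ) * γ u)) u‖ :=
        le_mul_of_one_le_left (norm_nonneg _) (one_le_pow₀ hw)
    _ ≤ D * (1 + |u|) ^ m / (t * (1 + |u|) ^ α) ^ k := h1
    _ ≤ |D| * (1 + |u|) ^ m / (t ^ k * (1 + |u|) ^ (m + 2)) := by
        rw [mul_pow]
        gcongr
        exact le_abs_self D
    _ = _ := by rw [pow_add]; field_simp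

theorem smalltime_prop63 (α : ℝ) (h0 : 0 < α) (h2 : α ≤ 2)
    (γ : ℝ → ℂ) (hγ : ContDiff ℝ (⊤ : ℕ∞) γ)
    (hderiv : ∀ i : ℕ, 1 ≤ i → ∃ ci u0i : ℝ, 0 < u0i ∧
      ∀ u : ℝ, u0i < |u| → ‖iteratedDeriv i γ u‖ ≤ ci * |u| ^ (α - (i : ℝ)))
    (hre : ∃ c0 u0 : ℝ, 0 < c0 ∧ 0 < u0 ∧
      ∀ u : ℝ, u0 < |u| → (γ u).re ≤ -c0 * |u| ^ α)
    (p : ℝ → ℝ → ℂ)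
    (hp : ∀ t : ℝ, 0 < t → ∀ x : ℝ,
      p t x = (1 / (2 * (π : ℂ))) *
        ∫ u : ℝ, Complex.exp (-Complex.I * u * x) * Complex.exp ((t : ℂ) * γ u)) :
    (∀ t : ℝ, 0 < t → ContDiff ℝ (⊤ : ℕ∞) (p t)) ∧
    ∀ m : ℕ, ∀ ε t0 : ℝ, 0 < ε → 0 < t0 → ∃ M : ℝ,
      ∀ t : ℝ, 0 < t → t ≤ t0 → ∀ x : ℝ, ε < |x| →
        ‖iteratedDeriv m (p t) x‖ ≤ M := by
  have hpF : ∀ t : ℝ, 0 < t → p t = fun x => (1 / (2 * (π : ℂ))) *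
      FourierTransform.fourier (fun u => Complex.exp ((t : ℂ) * γ u)) ((2 * π)⁻¹ * x) := by
    intro t ht
    funext x
    rw [hp t ht x, Real.fourier_real_eq_integral_exp_smul]
    congr 1
    refine integral_congr_ae (Filter.Eventually.of_forall fun u => ?_)
    simp only [smul_eq_mul]
    congr 2
    push_cast
    have : (π : ℂ) ≠ 0 := by exact_mod_cast pi_ne_zero
    field_simp
  have hint : ∀ t : ℝ, 0 < t → ∀ n : ℕ,
      Integrable (fun u : ℝ => u ^ n • Complex.exp ((t : ℂ) * γ u)) := by
    intro t ht n
    have h := (aux_gint α h0 γ hγ hderiv hre t ht n 0).const_mul (((-2 * π * Complex.I : ℂ) ^ n)⁻¹)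
    refine h.congr (Filter.Eventually.of_forall fun u => ?_)
    simp only [iteratedDeriv_zero, Complex.real_smul, mul_pow _ (u : ℂ)]
    have : (-2 * π * Complex.I : ℂ) ^ n ≠ 0 := by
      apply pow_ne_zero
      simp [pi_ne_zero]
    push_cast
    rw [mul_assoc (_ ^ n), inv_mul_cancel_left₀ this]
  have hFs : ∀ t : ℝ, 0 < t → ContDiff ℝ (⊤ : ℕ∞)
      (FourierTransform.fourier (fun u => Complex.exp ((t : ℂ) * γ u))) := by
    intro t ht
    refine Real.contDiff_fourier fun n _ => ?_
    refine (hint t ht n).norm.congr (Filter.Eventually.of_forall fun u => ?_)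
    simp only [norm_smul, norm_pow]
  refine ⟨fun t ht => ?_, fun m ε t0 hε ht0 => ?_⟩
  · rw [hpF t ht]
    exact contDiff_const.mul ((hFs t ht).comp (contDiff_const.mul contDiff_id))
  obtain ⟨D, hD⟩ := aux_g α h0 γ hγ hderiv hre t0 m (m + 2) 0
  set J := ∫ u : ℝ, D * ((1 + |u|) ^ 2)⁻¹ with hJ
  refine ⟨‖(1 / (2 * (π : ℂ)))‖ * (‖((2 * π)⁻¹ : ℝ) ^ m‖ * (J / ε ^ (m + 2))),
    fun t ht htt x hx => ?_⟩
  set g : ℝ → ℂ := fun u : ℝ => (-2 * π * Complex.I * u : ℂ) ^ m *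
        Complex.exp ((t : ℂ) * γ u) with hg
  have hm : ((m : ℕ∞) : WithTop ℕ∞) ≤ ((⊤ : ℕ∞) : WithTop ℕ∞) := by exact_mod_cast le_top
  have e1 : iteratedDeriv m (p t) x = (1 / (2 * (π : ℂ))) * (((2 * π)⁻¹ : ℝ) ^ m •
      FourierTransform.fourier g ((2 * π)⁻¹ * x)) := by
    rw [hpF t ht, iteratedDeriv_const_mul_field,
      iteratedDeriv_comp_const_smul ((hFs t ht).of_le hm),
      Real.iteratedDeriv_fourier (N := ⊤) (fun n _ => hint t ht n) le_top]
    rfl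
  have hcd : ContDiff ℝ ((⊤ : ℕ∞) : WithTop ℕ∞) g :=
    ((contDiff_const.mul Complex.ofRealCLM.contDiff).pow m).mul (aux_smooth γ hγ t)
  have e2 := congrFun (Real.fourier_iteratedDeriv (N := ⊤) (n := m + 2) hcd
    (fun n _ => aux_gint α h0 γ hγ hderiv hre t ht m n) le_top) ((2 * π)⁻¹ * x)
  have e3 : ‖FourierTransform.fourier (iteratedDeriv (m + 2) g) ((2 * π)⁻¹ * x)‖ ≤ J := by
    rw [Real.fourier_real_eq_integral_exp_smul]
    refine norm_integral_le_of_norm_le (aux_int2.const_mul D)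
      (Filter.Eventually.of_forall fun u => ?_)
    rw [norm_smul, Complex.norm_exp_ofReal_mul_I, one_mul]
    have := hD t ht htt u
    have hw0 : 0 < 1 + |u| := by positivity
    rw [pow_zero, div_one, pow_add] at this
    rw [← div_eq_mul_inv, le_div_iff₀ (by positivity)]
    refine le_of_mul_le_mul_left (a := (1 + |u|) ^ m) ?_ (by positivity)
    linarith
  have e4 : |x| ^ (m + 2) * ‖FourierTransform.fourier g ((2 * π)⁻¹ * x)‖ ≤ J := by
    rw [e2, norm_smul, norm_pow] at e3
    convert e3 using 3
    have : (2 * π * Complex.I * (((2 * π)⁻¹ * x : ℝ) : ℂ)) = Complex.I * x := by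
      have : (π : ℂ) ≠ 0 := by exact_mod_cast pi_ne_zero
      push_cast; field_simp
    rw [this]; simp
  rw [e1, norm_mul, norm_smul]
  gcongr
  rw [le_div_iff₀ (by positivity), mul_comm]
  refine le_trans ?_ e4
  gcongr
end

section
/- Let 0 < α < 2 and let F be a Borel measure on (0,∞) such that ∫₀^∞ λ^j F(dλ) < ∞ for every integer j ≥ 0. Define q : (0,∞) → [0,∞) by q(s) = ∫₀^∞ e^{−λs} F(dλ), and assume ∫₁^∞ s^{j−α−1} q(s) ds < ∞ for every integer j ≥ 1. Define γ : (0,∞) → ℝ by γ(u) = 2 ∫₀^∞ (1 − cos(us)) s^{−α−1} q(s) ds. Then γ is infinitely differentiable on (0,∞), its j-th derivative for j ≥ 1 is given by γ^{(j)}(u) = 2 ∫₀^∞ κ_{j−1}(us) s^{j−α−1} q(s) ds with κ_k = sin for k even and κ_k = cos for k odd (up to sign), and for every integer j ≥ 1 there exists a constant c_j < ∞ such that |γ^{(j)}(u)| ≤ c_j u^{α−j} for all u > 0. -/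
open MeasureTheory Real Set

/-- Uniform trigonometric kernel. -/
noncomputable def kap (j : ℕ) (x : ℝ) : ℝ :=
  (if j = 0 then 1 else 0) + (-Complex.I ^ j * Complex.exp (Complex.I * x)).re

lemma kap_zero (x : ℝ) : kap 0 x = 1 - Real.cos x := by
  simp [kap, mul_comm Complex.I, Complex.exp_ofReal_mul_I_re]; ring

lemma kap_one (x : ℝ) : kap 1 x = Real.sin x := by
  simp [kap, mul_comm Complex.I, Complex.exp_ofReal_mul_I_im]

lemma kap_succ (j : ℕ) (x : ℝ) : kap (j+1) x =
    (-1 : ℝ) ^ (j / 2) * (if j % 2 = 0 then Real.sin x else Real.cos x) := by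
  rcases Nat.even_or_odd' j with ⟨k, rfl | rfl⟩
  · have : Complex.I ^ (2*k+1) = (((-1:ℝ)^k : ℝ) : ℂ) * Complex.I := by
      rw [pow_succ, pow_mul]; simp
    simp only [kap, this]
    simp [mul_comm Complex.I, Complex.exp_ofReal_mul_I_im, mul_assoc, -Complex.ofReal_neg, -Complex.ofReal_pow]
  · have : Complex.I ^ (2*k+1+1) = (((-1:ℝ)^(k+1) : ℝ) : ℂ) := by
      rw [show 2*k+1+1 = 2*(k+1) by ring, pow_mul]; simp
    simp only [kap, this]
    have h2 : (2*k+1)/2 = k := by omega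
    have h3 : (2*k+1)%2 = 1 := by omega
    simp only [h2, h3, neg_mul, Complex.neg_re, Complex.re_ofReal_mul, mul_comm Complex.I, Complex.exp_ofReal_mul_I_re]
    simp [pow_succ]

lemma kap_deriv (j : ℕ) (x : ℝ) : HasDerivAt (kap j) (kap (j+1) x) x := by
  have h1 : HasDerivAt (fun y : ℝ => Complex.exp (Complex.I * y))
      (Complex.exp (Complex.I * x) * (Complex.I * 1)) x :=
    ((Complex.ofRealCLM.hasDerivAt (x := x)).const_mul Complex.I).cexp
  have h2 := (h1.const_mul (-Complex.I ^ j))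
  have h3 := (Complex.reCLM.hasFDerivAt.comp_hasDerivAt x h2).const_add (if j = 0 then (1:ℝ) else 0)
  refine h3.congr_deriv ?_
  simp only [kap, Complex.reCLM_apply, Nat.succ_ne_zero, if_false, zero_add, pow_succ]
  congr 1
  ring

lemma kap_cont (j : ℕ) : Continuous (kap j) :=
  continuous_iff_continuousAt.2 fun x => (kap_deriv j x).continuousAt

lemma kap_le_one (j : ℕ) (x : ℝ) : |kap (j+1) x| ≤ 1 := by
  simp only [kap, Nat.succ_ne_zero, if_false, zero_add]
  refine (Complex.abs_re_le_norm _).trans ?_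
  simp [mul_comm Complex.I, Complex.norm_exp_ofReal_mul_I]

lemma kap_one_le (x : ℝ) : |kap 1 x| ≤ |x| := by
  rw [kap_one]; exact Real.abs_sin_le_abs

lemma kap_zero_le (x : ℝ) : |kap 0 x| ≤ x ^ 2 := by
  rw [kap_zero, abs_of_nonneg (by linarith [Real.cos_le_one x])]
  nlinarith [Real.one_sub_sq_div_two_le_cos (x := x)]

lemma intOn_exp {a l : ℝ} (ha : 0 < a) (hl : 0 < l) :
    IntegrableOn (fun s : ℝ => s ^ (a - 1) * Real.exp (-(l * s))) (Ioi 0) := by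
  have := integrableOn_rpow_mul_exp_neg_mul_rpow (p := 1) (s := a - 1) (b := l) (by linarith) one_pos hl
  simpa using this

lemma norm_ge {l u : ℝ} (hu : 0 < u) : u ≤ ‖(l : ℂ) - Complex.I * u‖ := by
  refine le_trans ?_ (Complex.abs_im_le_norm _)
  simp [abs_of_pos hu]

/-- Complex Laplace integrand. -/
noncomputable def lapK (l u b s : ℝ) : ℂ :=
  ((s ^ b : ℝ) : ℂ) * Complex.exp (-(((l : ℂ) - Complex.I * u) * s))

lemma norm_cexp (l u s : ℝ) :
    ‖Complex.exp (-(((l : ℂ) - Complex.I * u) * s))‖ = Real.exp (-(l * s)) := by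
  rw [Complex.norm_exp]; simp

lemma norm_lapK (l u b : ℝ) {s : ℝ} (hs : 0 ≤ s) :
    ‖lapK l u b s‖ = s ^ b * Real.exp (-(l * s)) := by
  rw [lapK, norm_mul, norm_cexp, Complex.norm_real, Real.norm_of_nonneg (Real.rpow_nonneg hs _)]

lemma meas_lapK (l u b : ℝ) : Measurable (lapK l u b) := by
  unfold lapK
  fun_prop

lemma intOn_lapK {l u b c : ℝ} (hc : 0 ≤ c)
    (h : IntegrableOn (fun s : ℝ => s ^ b * Real.exp (-(l * s))) (Ioi c)) :
    IntegrableOn (lapK l u b) (Ioi c) := by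
  refine Integrable.mono' h (meas_lapK l u b).aestronglyMeasurable ?_
  refine (ae_restrict_iff' measurableSet_Ioi).2 (Filter.Eventually.of_forall fun s hs => ?_)
  rw [norm_lapK l u b (hc.trans (le_of_lt hs))]

lemma lapK_ftc {l u b c : ℝ} (hl : 0 < l) (hu : 0 < u) (hc : 0 ≤ c) (hcb : 0 < c ∨ 0 < b)
    (h1 : IntegrableOn (fun s : ℝ => s ^ b * Real.exp (-(l * s))) (Ioi c))
    (h2 : IntegrableOn (fun s : ℝ => s ^ (b - 1) * Real.exp (-(l * s))) (Ioi c)) :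
    ∫ s in Ioi c, lapK l u b s =
      (lapK l u b c + b * ∫ s in Ioi c, lapK l u (b - 1) s) / ((l : ℂ) - Complex.I * u) := by
  set r : ℂ := (l : ℂ) - Complex.I * u with hr
  have hr0 : r ≠ 0 := by
    intro h
    have := norm_ge (l := l) hu
    rw [← hr, h, norm_zero] at this
    linarith
  have key : ∫ s in Ioi c, (b * lapK l u (b-1) s - r * lapK l u b s) = 0 - lapK l u b c := by
    apply integral_Ioi_of_hasDerivAt_of_tendsto (f := lapK l u b)
    · apply ContinuousAt.continuousWithinAt
      unfold lapK
      have : ContinuousAt (fun s : ℝ => s ^ b) c := by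
        apply Real.continuousAt_rpow_const
        rcases hcb with h | h
        · exact Or.inl h.ne'
        · exact Or.inr h.le
      exact (Complex.continuous_ofReal.continuousAt.comp this).mul (by fun_prop)
    · intro s hs
      have hs0 : 0 < s := hc.trans_lt hs
      have hp := (Real.hasDerivAt_rpow_const (x := s) (p := b) (Or.inl hs0.ne')).ofReal_comp
      have he : HasDerivAt (fun y : ℝ => Complex.exp (-(r * y)))
          (Complex.exp (-(r * s)) * (-(r * 1))) s :=
        (((Complex.ofRealCLM.hasDerivAt (x := s)).const_mul r).neg).cexp
      refine (hp.mul he).congr_deriv ?_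
      simp only [lapK, ← hr]
      push_cast
      ring
    · exact ((intOn_lapK hc h2).const_mul _).sub ((intOn_lapK hc h1).const_mul _)
    · rw [tendsto_zero_iff_norm_tendsto_zero]
      refine (tendsto_rpow_mul_exp_neg_mul_atTop_nhds_zero b l hl).congr' ?_
      filter_upwards [Filter.eventually_ge_atTop 0] with s hs
      rw [norm_lapK l u b hs, neg_mul]
  rw [integral_sub ((intOn_lapK hc h2).const_mul _) ((intOn_lapK hc h1).const_mul _),
    integral_const_mul, integral_const_mul] at key
  rw [eq_div_iff hr0]
  linear_combination -key

lemma intOn_neg {l b c : ℝ} (hl : 0 < l) (hc : 0 < c) (hb : b ≤ 0) :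
    IntegrableOn (fun s : ℝ => s ^ b * Real.exp (-(l * s))) (Ioi c) := by
  have h := (intOn_exp (a := 1) one_pos hl).mono_set (Ioi_subset_Ioi hc.le)
  refine Integrable.mono' (h.const_mul (c ^ b)) (by fun_prop) ?_
  refine (ae_restrict_iff' measurableSet_Ioi).2 (Filter.Eventually.of_forall fun s hs => ?_)
  have hs' : c < s := hs
  have hs0 : 0 < s := hc.trans hs
  rw [Real.norm_of_nonneg (by positivity)]
  simp only [sub_self, Real.rpow_zero, one_mul]
  gcongr ?_ * _
  exact Real.rpow_le_rpow_of_nonpos hc hs'.le hb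

lemma tail_bound {l u b : ℝ} (hl : 0 < l) (hu : 0 < u) (hb : b ≤ 0) :
    ‖∫ s in Ioi (1/u), lapK l u b s‖ ≤ 2 * u ^ (-b - 1) := by
  have hc : 0 < 1/u := by positivity
  rw [lapK_ftc hl hu hc.le (Or.inl hc) (intOn_neg hl hc hb) (intOn_neg hl hc (by linarith)),
    norm_div]
  have hpow : (1/u) ^ b = u ^ (-b) := by
    rw [one_div, Real.inv_rpow hu.le, Real.rpow_neg hu.le]
  have e1 : ‖lapK l u b (1/u)‖ ≤ u ^ (-b) := by
    rw [norm_lapK _ _ _ hc.le, hpow]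
    have : Real.exp (-(l * (1/u))) ≤ 1 := Real.exp_le_one_iff.2 (by simp; positivity)
    exact mul_le_of_le_one_right (by positivity) this
  have e2 : ‖(b:ℂ) * ∫ s in Ioi (1/u), lapK l u (b - 1) s‖ ≤ u ^ (-b) := by
    rcases hb.eq_or_lt with rfl | hb'
    · simp
    · have : ‖∫ s in Ioi (1/u), lapK l u (b - 1) s‖ ≤ ∫ s in Ioi (1/u), s ^ (b-1) := by
        refine norm_integral_le_of_norm_le (integrableOn_Ioi_rpow_of_lt (by linarith) hc) ?_
        refine (ae_restrict_iff' measurableSet_Ioi).2 (Filter.Eventually.of_forall fun s hs => ?_)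
        have hs0 : 0 < s := hc.trans hs
        rw [norm_lapK _ _ _ hs0.le]
        exact mul_le_of_le_one_right (by positivity)
          (Real.exp_le_one_iff.2 (by simp; positivity))
      rw [integral_Ioi_rpow_of_lt (by linarith) hc, sub_add_cancel, hpow] at this
      rw [norm_mul, Complex.norm_real, Real.norm_of_nonpos hb]
      calc -b * _ ≤ -b * (-u ^ (-b) / b) := by gcongr; linarith
        _ = u ^ (-b) := by
          have := hb'.ne
          field_simp
  have := norm_ge (l := l) hu
  calc _ ≤ (u ^ (-b) + u ^ (-b)) / u := by
        gcongr
        exact (norm_add_le _ _).trans (add_le_add e1 e2)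
    _ = 2 * u ^ (-b - 1) := by rw [Real.rpow_sub hu, Real.rpow_one]; ring

lemma head_rpow {a u : ℝ} (ha : 0 < a) (hu : 0 < u) :
    IntegrableOn (fun s : ℝ => s ^ (a - 1)) (Ioc 0 (1/u)) ∧
    ∫ s in Ioc 0 (1/u), s ^ (a - 1) = u ^ (-a) / a := by
  have hc : 0 < 1/u := by positivity
  constructor
  · exact (intervalIntegrable_iff_integrableOn_Ioc_of_le hc.le).1
      (intervalIntegral.intervalIntegrable_rpow' (by linarith))
  · rw [← intervalIntegral.integral_of_le hc.le, integral_rpow (Or.inl (by linarith)),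
      sub_add_cancel, Real.zero_rpow ha.ne', one_div, Real.inv_rpow hu.le, Real.rpow_neg hu.le,
      sub_zero]

lemma split_int {f : ℝ → ℂ} {c : ℝ} (hc : 0 ≤ c) (h : IntegrableOn f (Ioi 0)) :
    ∫ s in Ioi 0, f s = (∫ s in Ioc 0 c, f s) + ∫ s in Ioi c, f s := by
  rw [← setIntegral_union Ioc_disjoint_Ioi_same measurableSet_Ioi
    (h.mono_set Ioc_subset_Ioi_self) (h.mono_set (Ioi_subset_Ioi hc)), Ioc_union_Ioi_eq_Ioi hc]

lemma lapK_bound (n : ℕ) : ∀ a : ℝ, 0 < a → a ≤ n + 1 → ∃ C : ℝ, ∀ l u : ℝ, 0 < l → 0 < u →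
    ‖∫ s in Ioi (0:ℝ), lapK l u (a - 1) s‖ ≤ C * u ^ (-a) := by
  induction n with
  | zero =>
    intro a ha ha1
    refine ⟨1 / a + 2, fun l u hl hu => ?_⟩
    have hc : 0 < 1/u := by positivity
    have ha1' : a ≤ 1 := by simpa using ha1
    have hi := intOn_lapK (u := u) le_rfl (intOn_exp ha hl)
    rw [split_int hc.le hi]
    have e1 : ‖∫ s in Ioc 0 (1/u), lapK l u (a-1) s‖ ≤ ∫ s in Ioc 0 (1/u), s ^ (a-1) := by
      refine norm_integral_le_of_norm_le (head_rpow ha hu).1 ?_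
      refine (ae_restrict_iff' measurableSet_Ioc).2 (Filter.Eventually.of_forall fun s hs => ?_)
      have hs0 : 0 < s := hs.1
      rw [norm_lapK _ _ _ hs0.le]
      exact mul_le_of_le_one_right (by positivity)
          (Real.exp_le_one_iff.2 (by simp; positivity))
    rw [(head_rpow ha hu).2] at e1
    have e2 := tail_bound (b := a - 1) hl hu (by linarith)
    rw [show -(a-1)-1 = -a by ring] at e2
    calc _ ≤ u ^ (-a) / a + 2 * u ^ (-a) := (norm_add_le _ _).trans (add_le_add e1 e2)
      _ = _ := by ring
  | succ n ih =>
    intro a ha han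
    push_cast at han
    by_cases h : a ≤ n + 1
    · exact ih a ha h
    · push Not at h
      have hb : 0 < a - 1 := by
        have : (0:ℝ) ≤ n := n.cast_nonneg
        linarith
      obtain ⟨C, hC⟩ := ih (a - 1) hb (by linarith)
      refine ⟨(a - 1) * C, fun l u hl hu => ?_⟩
      rw [lapK_ftc hl hu le_rfl (Or.inr hb) (intOn_exp ha hl) (intOn_exp hb hl)]
      have : lapK l u (a-1) 0 = 0 := by simp [lapK, Real.zero_rpow hb.ne']
      have hn := norm_ge (l := l) hu
      have hCC := hC l u hl hu
      rw [this, zero_add, norm_div, norm_mul, Complex.norm_real, Real.norm_of_nonneg hb.le]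
      calc _ ≤ (a - 1) * (C * u ^ (-(a-1))) / u := by
            have : 0 ≤ C * u ^ (-(a-1)) := (norm_nonneg _).trans hCC
            gcongr
        _ = _ := by
            rw [show -(a-1) = -a + 1 by ring, Real.rpow_add hu, Real.rpow_one]
            field_simp

lemma kap_lapK (j : ℕ) (l u b s : ℝ) : kap (j+1) (u * s) * s ^ b * Real.exp (-(l * s)) =
    Complex.reCLM (-Complex.I ^ (j+1) * lapK l u b s) := by
  have : Complex.exp (-(((l : ℂ) - Complex.I * u) * s)) =
      ((Real.exp (-(l*s)) : ℝ) : ℂ) * Complex.exp (Complex.I * (u * s : ℝ)) := by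
    push_cast
    rw [← Complex.exp_add]
    congr 1; ring
  simp only [kap, lapK, this, Nat.succ_ne_zero, if_false, zero_add, Complex.reCLM_apply]
  rw [show -Complex.I ^ (j+1) * (((s ^ b : ℝ) : ℂ) * (((Real.exp (-(l*s)) : ℝ) : ℂ) *
      Complex.exp (Complex.I * (u * s : ℝ)))) = ((s ^ b * Real.exp (-(l*s)) : ℝ) : ℂ) *
      (-Complex.I ^ (j+1) * Complex.exp (Complex.I * (u * s : ℝ))) by push_cast; ring,
    Complex.re_ofReal_mul]
  ring

lemma kap_int_le (j : ℕ) (l u b : ℝ) (S : Set ℝ) (h : IntegrableOn (lapK l u b) S) :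
    |∫ s in S, kap (j+1) (u * s) * s ^ b * Real.exp (-(l * s))| ≤ ‖∫ s in S, lapK l u b s‖ := by
  simp only [kap_lapK]
  rw [ContinuousLinearMap.integral_comp_comm _ (h.const_mul _), integral_const_mul]
  refine (Complex.abs_re_le_norm _).trans ?_
  simp

lemma kernel_bound_one {α l u : ℝ} (h0 : 0 < α) (h2 : α < 2) (hl : 0 < l) (hu : 0 < u) :
    |∫ s in Ioi (0:ℝ), kap 1 (u * s) * s ^ (-α) * Real.exp (-(l * s))|
      ≤ (1 / (2 - α) + 2) * u ^ (α - 1) := by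
  have hc : 0 < 1/u := by positivity
  have ha : 0 < 2 - α := by linarith
  have hR := head_rpow ha hu
  have hpt : ∀ s ∈ Ioc 0 (1/u), ‖kap 1 (u * s) * s ^ (-α) * Real.exp (-(l * s))‖
      ≤ u * s ^ (2 - α - 1) := by
    intro s hs
    have hs0 : 0 < s := hs.1
    rw [norm_mul, norm_mul, Real.norm_of_nonneg (Real.exp_pos _).le,
      Real.norm_of_nonneg (Real.rpow_nonneg hs0.le _)]
    have h1 := kap_one_le (u * s)
    rw [abs_of_pos (show 0 < u * s by positivity)] at h1
    have h3 : Real.exp (-(l * s)) ≤ 1 := Real.exp_le_one_iff.2 (by simp; positivity)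
    calc _ ≤ (u * s) * s ^ (-α) * 1 := by
          rw [Real.norm_eq_abs]
          gcongr
      _ = _ := by
          rw [show 2 - α - 1 = -α + 1 by ring, Real.rpow_add hs0, Real.rpow_one]; ring
  have hm : Measurable (fun s : ℝ => kap 1 (u * s) * s ^ (-α) * Real.exp (-(l * s))) := by
    have := (kap_cont 1).measurable
    fun_prop
  have hae : ∀ᵐ s ∂(volume.restrict (Ioc 0 (1/u))),
      ‖kap 1 (u * s) * s ^ (-α) * Real.exp (-(l * s))‖ ≤ u * s ^ (2 - α - 1) :=
    (ae_restrict_iff' measurableSet_Ioc).2 (Filter.Eventually.of_forall hpt)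
  have hi1 : IntegrableOn (fun s : ℝ => kap 1 (u * s) * s ^ (-α) * Real.exp (-(l * s)))
      (Ioc 0 (1/u)) := Integrable.mono' (hR.1.const_mul u) hm.aestronglyMeasurable hae
  have hL : IntegrableOn (lapK l u (-α)) (Ioi (1/u)) :=
    intOn_lapK hc.le (intOn_neg hl hc (by linarith))
  have hi2 : IntegrableOn (fun s : ℝ => kap 1 (u * s) * s ^ (-α) * Real.exp (-(l * s)))
      (Ioi (1/u)) := by
    simp only [kap_lapK 0]
    exact Complex.reCLM.integrable_comp (hL.const_mul _)
  rw [← Ioc_union_Ioi_eq_Ioi hc.le, setIntegral_union Ioc_disjoint_Ioi_same measurableSet_Ioi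
    hi1 hi2]
  have e1 := norm_integral_le_of_norm_le (hR.1.const_mul u) hae
  rw [integral_const_mul, hR.2] at e1
  have e2 := (kap_int_le 0 l u (-α) _ hL).trans (tail_bound hl hu (by linarith))
  rw [neg_neg] at e2
  refine (abs_add_le _ _).trans ((add_le_add e1 e2).trans (le_of_eq ?_))
  rw [show -(2 - α) = (α - 1) - 1 by ring, Real.rpow_sub hu (α - 1), Real.rpow_one]
  field_simp

lemma kernel_bound {α : ℝ} (h0 : 0 < α) (h2 : α < 2) (j : ℕ) : ∃ C : ℝ, ∀ l u : ℝ, 0 < l → 0 < u →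
    |∫ s in Ioi (0:ℝ), kap (j+1) (u * s) * s ^ (((j+1 : ℕ) : ℝ) - α - 1) * Real.exp (-(l * s))|
      ≤ C * u ^ (α - ((j+1 : ℕ) : ℝ)) := by
  rcases Nat.eq_zero_or_pos j with rfl | hj
  · refine ⟨1 / (2 - α) + 2, fun l u hl hu => ?_⟩
    have := kernel_bound_one h0 h2 hl hu
    simpa using this
  · have hj' : (1:ℝ) ≤ j := by exact_mod_cast hj
    have ha : 0 < ((j+1 : ℕ) : ℝ) - α := by push_cast; linarith
    obtain ⟨C, hC⟩ := lapK_bound j _ ha (by push_cast; linarith)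
    refine ⟨C, fun l u hl hu => ?_⟩
    have := (kap_int_le j l u _ _ (intOn_lapK (u := u) le_rfl (intOn_exp ha hl))).trans
      (hC l u hl hu)
    rwa [neg_sub] at this

/-- The weighted integrals. -/
noncomputable def GG (α : ℝ) (q : ℝ → ℝ) (j : ℕ) (u : ℝ) : ℝ :=
  2 * ∫ s in Ioi (0:ℝ), kap j (u * s) * s ^ ((j : ℝ) - α - 1) * q s

lemma w_int {α M : ℝ} (h2 : α < 2) {q : ℝ → ℝ} (hqm : Measurable q)
    (hqb : ∀ s, 0 < s → |q s| ≤ M)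
    (hqtail : ∀ j : ℕ, 1 ≤ j →
      IntegrableOn (fun s : ℝ => s ^ ((j : ℝ) - α - 1) * q s) (Ioi 1)) (j : ℕ) :
    IntegrableOn (fun s : ℝ => s ^ (((j+2 : ℕ) : ℝ) - α - 1) * q s) (Ioi 0) := by
  rw [← Ioc_union_Ioi_eq_Ioi (zero_le_one (α := ℝ))]
  refine IntegrableOn.union ?_ (hqtail _ (by omega))
  have ha : 0 < ((j+2 : ℕ) : ℝ) - α := by
    have : (0:ℝ) ≤ j := j.cast_nonneg
    push_cast; linarith
  have h := (head_rpow ha one_pos).1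
  rw [div_one] at h
  refine Integrable.mono' (h.mul_const M) (by fun_prop) ?_
  refine (ae_restrict_iff' measurableSet_Ioc).2 (Filter.Eventually.of_forall fun s hs => ?_)
  have hs0 : 0 < s := hs.1
  rw [norm_mul, Real.norm_of_nonneg (Real.rpow_nonneg hs0.le _), Real.norm_eq_abs]
  gcongr
  exact hqb s hs0

lemma meas_integrand {α : ℝ} {q : ℝ → ℝ} (hqm : Measurable q) (j : ℕ) (u : ℝ) :
    Measurable (fun s : ℝ => kap j (u * s) * s ^ ((j : ℝ) - α - 1) * q s) := by
  have := (kap_cont j).measurable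
  fun_prop

lemma kap_w_le (α : ℝ) (q : ℝ → ℝ) (j : ℕ) (u : ℝ) {s : ℝ} (hs : 0 < s) :
    ‖kap (j+1) (u * s) * s ^ (((j+1 : ℕ) : ℝ) - α - 1) * q s‖ ≤
      (if j = 0 then |u| else 1) *
        ‖s ^ (((j-1+2 : ℕ) : ℝ) - α - 1) * q s‖ := by
  rw [norm_mul, norm_mul, norm_mul, Real.norm_of_nonneg (Real.rpow_nonneg hs.le _),
    Real.norm_of_nonneg (Real.rpow_nonneg hs.le _), ← mul_assoc]
  gcongr ?_ * _
  rw [Real.norm_eq_abs]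
  rcases Nat.eq_zero_or_pos j with rfl | hj
  · have h1 := kap_one_le (u * s)
    rw [abs_mul, abs_of_pos hs] at h1
    simp only [if_true]
    calc _ ≤ |u| * s * s ^ (((0+1 : ℕ) : ℝ) - α - 1) := by gcongr
      _ = _ := by
        rw [mul_assoc, mul_comm s, ← Real.rpow_add_one hs.ne']
        congr 2; push_cast; ring
  · obtain ⟨k, rfl⟩ : ∃ k, j = k + 1 := ⟨j - 1, by omega⟩
    simp only [Nat.succ_ne_zero, if_false, Nat.add_sub_cancel]
    gcongr
    exact kap_le_one _ _

lemma kap0_w_le (α : ℝ) (q : ℝ → ℝ) (u : ℝ) {s : ℝ} (hs : 0 < s) :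
    ‖kap 0 (u * s) * s ^ (((0 : ℕ) : ℝ) - α - 1) * q s‖ ≤
      u ^ 2 * ‖s ^ (((0+2 : ℕ) : ℝ) - α - 1) * q s‖ := by
  rw [norm_mul, norm_mul, norm_mul, Real.norm_of_nonneg (Real.rpow_nonneg hs.le _),
    Real.norm_of_nonneg (Real.rpow_nonneg hs.le _), ← mul_assoc]
  gcongr ?_ * _
  rw [Real.norm_eq_abs]
  calc _ ≤ (u * s) ^ 2 * s ^ (((0 : ℕ) : ℝ) - α - 1) := by gcongr; exact kap_zero_le _
    _ = u ^ 2 * (s ^ 2 * s ^ (((0 : ℕ) : ℝ) - α - 1)) := by ring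
    _ = _ := by
      rw [← Real.rpow_natCast s 2, ← Real.rpow_add hs]
      congr 2; push_cast; ring

section
variable {α : ℝ} {q : ℝ → ℝ}

lemma integrand_int (hqm : Measurable q)
    (hw : ∀ j : ℕ, IntegrableOn (fun s : ℝ => s ^ (((j+2 : ℕ) : ℝ) - α - 1) * q s) (Ioi 0))
    (j : ℕ) (u : ℝ) :
    IntegrableOn (fun s : ℝ => kap j (u * s) * s ^ ((j : ℝ) - α - 1) * q s) (Ioi 0) := by
  rcases j with _ | j
  · refine Integrable.mono' ((hw 0).norm.const_mul (u^2))
      (meas_integrand hqm _ _).aestronglyMeasurable ?_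
    exact (ae_restrict_iff' measurableSet_Ioi).2
      (Filter.Eventually.of_forall fun s hs => kap0_w_le α q u hs)
  · refine Integrable.mono' ((hw (j-1)).norm.const_mul (if j = 0 then |u| else 1))
      (meas_integrand hqm _ _).aestronglyMeasurable ?_
    exact (ae_restrict_iff' measurableSet_Ioi).2
      (Filter.Eventually.of_forall fun s hs => kap_w_le α q j u hs)

lemma GG_deriv (hqm : Measurable q)
    (hw : ∀ j : ℕ, IntegrableOn (fun s : ℝ => s ^ (((j+2 : ℕ) : ℝ) - α - 1) * q s) (Ioi 0))
    (j : ℕ) (u : ℝ) : HasDerivAt (GG α q j) (GG α q (j+1) u) u := by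
  unfold GG
  refine HasDerivAt.const_mul 2 ?_
  refine (hasDerivAt_integral_of_dominated_loc_of_deriv_le
    (bound := fun s => (|u| + 1) * ‖s ^ (((j-1+2 : ℕ) : ℝ) - α - 1) * q s‖)
    (F := fun u s => kap j (u * s) * s ^ ((j : ℝ) - α - 1) * q s)
    (F' := fun u s => kap (j+1) (u * s) * s ^ (((j+1 : ℕ) : ℝ) - α - 1) * q s)
    (Metric.ball_mem_nhds u one_pos)
    (Filter.Eventually.of_forall fun v => (meas_integrand hqm _ _).aestronglyMeasurable)
    (integrand_int hqm hw j u) (meas_integrand hqm _ _).aestronglyMeasurable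
    ?_ ((hw (j-1)).norm.const_mul _) ?_).2
  · refine (ae_restrict_iff' measurableSet_Ioi).2 (Filter.Eventually.of_forall fun s hs v hv => ?_)
    refine (kap_w_le α q j v hs).trans ?_
    gcongr
    split_ifs
    · rw [Metric.mem_ball, Real.dist_eq] at hv
      have := abs_add_le (v - u) u
      rw [sub_add_cancel] at this
      linarith
    · linarith [abs_nonneg u]
  · refine (ae_restrict_iff' measurableSet_Ioi).2 (Filter.Eventually.of_forall fun s hs v _ => ?_)
    have hs0 : (0:ℝ) < s := hs
    have h1 : HasDerivAt (fun v : ℝ => v * s) s v := by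
      simpa using (hasDerivAt_id v).mul_const s
    have h2 := (((kap_deriv j (v * s)).comp v h1).mul_const (s ^ ((j : ℝ) - α - 1))).mul_const (q s)
    refine h2.congr_deriv ?_
    rw [show (((j+1 : ℕ) : ℝ) - α - 1) = ((j : ℝ) - α - 1) + 1 by push_cast; ring,
      Real.rpow_add_one hs0.ne']
    ring

end

lemma GG_bound {α : ℝ} (h0 : 0 < α) (h2 : α < 2) (μ : Measure ℝ) [IsFiniteMeasure μ]
    (hμ : ∀ᵐ l ∂μ, 0 < l) {q : ℝ → ℝ} (hqm : Measurable q)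
    (hq : ∀ s : ℝ, q s = ∫ lam, Real.exp (-(lam * s)) ∂μ)
    (hexp : ∀ s : ℝ, 0 < s → Integrable (fun lam => Real.exp (-(lam * s))) μ)
    (hw : ∀ j : ℕ, IntegrableOn (fun s : ℝ => s ^ (((j+2 : ℕ) : ℝ) - α - 1) * q s) (Ioi 0))
    (j : ℕ) : ∃ c : ℝ, ∀ u : ℝ, 0 < u → |GG α q (j+1) u| ≤ c * u ^ (α - ((j+1 : ℕ) : ℝ)) := by
  obtain ⟨C, hC⟩ := kernel_bound h0 h2 j
  refine ⟨2 * (C * μ.real univ), fun u hu => ?_⟩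
  have hmk := (kap_cont (j+1)).measurable
  have hint : Integrable (Function.uncurry fun s lam : ℝ =>
      kap (j+1) (u * s) * s ^ (((j+1 : ℕ) : ℝ) - α - 1) * Real.exp (-(lam * s)))
      ((volume.restrict (Ioi 0)).prod μ) := by
    rw [integrable_prod_iff (by
      apply Measurable.aestronglyMeasurable
      unfold Function.uncurry
      fun_prop)]
    constructor
    · exact (ae_restrict_iff' measurableSet_Ioi).2
        (Filter.Eventually.of_forall fun s hs => (hexp s hs).const_mul
          (kap (j+1) (u * s) * s ^ (((j+1 : ℕ) : ℝ) - α - 1)))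
    · refine (integrand_int hqm hw (j+1) u).norm.congr ?_
      refine Filter.Eventually.of_forall fun s => ?_
      simp only [Function.uncurry]
      rw [hq s, ← integral_const_mul]
      rw [integral_const_mul, norm_mul]
      simp only [norm_mul (kap (j+1) (u * s) * s ^ (((j+1 : ℕ) : ℝ) - α - 1))]
      rw [integral_const_mul, Real.norm_of_nonneg (integral_nonneg fun _ => (Real.exp_pos _).le)]
      simp
  have hsw := integral_integral_swap hint
  have : GG α q (j+1) u = 2 * ∫ lam, (∫ s in Ioi (0:ℝ),
      kap (j+1) (u * s) * s ^ (((j+1 : ℕ) : ℝ) - α - 1) * Real.exp (-(lam * s))) ∂μ := by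
    rw [← hsw, GG]
    congr 1
    refine integral_congr_ae (Filter.Eventually.of_forall fun s => ?_)
    simp only
    rw [hq s, integral_const_mul]
  rw [this, abs_mul, abs_two, mul_assoc]
  gcongr
  have := norm_integral_le_of_norm_le_const (μ := μ) (C := C * u ^ (α - ((j+1 : ℕ) : ℝ)))
    (f := fun lam => ∫ s in Ioi (0:ℝ),
      kap (j+1) (u * s) * s ^ (((j+1 : ℕ) : ℝ) - α - 1) * Real.exp (-(lam * s)))
    (hμ.mono fun l hl => hC l u hl hu)
  refine this.trans (le_of_eq ?_)
  ring

theorem smalltime_prop64 (α : ℝ) (h0 : 0 < α) (h2 : α < 2)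
    (F : Measure ℝ)
    (hF : ∀ j : ℕ, IntegrableOn (fun lam : ℝ => lam ^ j) (Ioi 0) F)
    (q : ℝ → ℝ)
    (hq : ∀ s : ℝ, q s = ∫ lam in Ioi (0:ℝ), Real.exp (-(lam * s)) ∂F)
    (hqtail : ∀ j : ℕ, 1 ≤ j →
      IntegrableOn (fun s : ℝ => s ^ ((j : ℝ) - α - 1) * q s) (Ioi 1))
    (γ : ℝ → ℝ)
    (hγ : ∀ u : ℝ, γ u = 2 * ∫ s in Ioi (0:ℝ), (1 - Real.cos (u * s)) * s ^ (-α - 1) * q s) :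
    ContDiffOn ℝ (⊤ : ℕ∞) γ (Ioi 0) ∧
    (∀ j : ℕ, 1 ≤ j → ∀ u : ℝ, 0 < u →
      iteratedDerivWithin j γ (Ioi 0) u =
        (-1 : ℝ) ^ ((j - 1) / 2) * 2 *
          ∫ s in Ioi (0:ℝ),
            (if (j - 1) % 2 = 0 then Real.sin (u * s) else Real.cos (u * s)) *
              s ^ ((j : ℝ) - α - 1) * q s) ∧
    ∀ j : ℕ, 1 ≤ j → ∃ cj : ℝ, ∀ u : ℝ, 0 < u →
      |iteratedDerivWithin j γ (Ioi 0) u| ≤ cj * u ^ (α - (j : ℝ)) := by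
  have hfin : IsFiniteMeasure (F.restrict (Ioi 0)) := by
    have := hF 0
    simp only [pow_zero] at this
    have h := (integrable_const_iff (c := (1:ℝ)) (μ := F.restrict (Ioi 0))).1 this
    simpa using h
  have hpos : ∀ᵐ l ∂(F.restrict (Ioi 0)), (0:ℝ) < l := ae_restrict_mem measurableSet_Ioi
  have hqm : Measurable q := by
    have : q = fun s => ∫ lam, Real.exp (-(lam * s)) ∂(F.restrict (Ioi 0)) := funext hq
    rw [this]
    refine (StronglyMeasurable.integral_prod_right
      (f := fun s lam : ℝ => Real.exp (-(lam * s))) ?_).measurable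
    apply Measurable.stronglyMeasurable
    unfold Function.uncurry
    fun_prop
  have hle : ∀ s : ℝ, 0 < s → ∀ᵐ l ∂(F.restrict (Ioi 0)), ‖Real.exp (-(l * s))‖ ≤ 1 := by
    intro s hs
    filter_upwards [hpos] with l hl
    rw [Real.norm_of_nonneg (Real.exp_pos _).le]
    exact Real.exp_le_one_iff.2 (by simp; positivity)
  have hexp : ∀ s : ℝ, 0 < s →
      Integrable (fun lam => Real.exp (-(lam * s))) (F.restrict (Ioi 0)) := fun s hs =>
    Integrable.mono' (integrable_const (1:ℝ)) (by fun_prop) (hle s hs)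
  have hqb : ∀ s : ℝ, 0 < s → |q s| ≤ 1 * (F.restrict (Ioi 0)).real univ := by
    intro s hs
    rw [hq s]
    exact norm_integral_le_of_norm_le_const (hle s hs)
  have hw := w_int h2 hqm hqb hqtail
  have hG0 : γ = GG α q 0 := by
    funext u
    rw [hγ u, GG]
    simp only [kap_zero, Nat.cast_zero, zero_sub]
  have hGd := GG_deriv hqm hw
  have hit : ∀ j, iteratedDeriv j γ = GG α q j := by
    intro j
    induction j with
    | zero => rw [iteratedDeriv_zero, hG0]
    | succ j ih =>
      rw [iteratedDeriv_succ, ih]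
      funext u
      exact (hGd j u).deriv
  have hitw : ∀ j u, 0 < u → iteratedDerivWithin j γ (Ioi 0) u = GG α q j u := by
    intro j u hu
    rw [iteratedDerivWithin_of_isOpen isOpen_Ioi hu, hit]
  refine ⟨?_, ?_, ?_⟩
  · have hcd : ContDiff ℝ (⊤ : ℕ∞) γ := by
      refine contDiff_of_differentiable_iteratedDeriv fun m _ => ?_
      rw [hit]
      exact fun u => (hGd m u).differentiableAt
    exact hcd.contDiffOn
  · intro j hj u hu
    obtain ⟨k, rfl⟩ : ∃ k, j = k + 1 := ⟨j - 1, by omega⟩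
    rw [hitw _ _ hu, GG, Nat.add_sub_cancel, mul_comm ((-1:ℝ)^(k/2)) 2, mul_assoc,
      ← integral_const_mul ((-1:ℝ)^(k/2))]
    congr 1
    refine integral_congr_ae (Filter.Eventually.of_forall fun s => ?_)
    simp only [kap_succ]
    ring
  · intro j hj
    obtain ⟨k, rfl⟩ : ∃ k, j = k + 1 := ⟨j - 1, by omega⟩
    obtain ⟨c, hc⟩ := GG_bound h0 h2 (F.restrict (Ioi 0)) hpos hqm hq hexp hw k
    refine ⟨c, fun u hu => ?_⟩
    rw [hitw _ _ hu]
    exact hc u hu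
end
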